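/- Let k be an algebraically closed field of characteristic zero and let B be an affine k-domain of Krull dimension 3 such that B[t] ≅ k^[4] as k-algebras (i.e., the cylinder X × 𝔸¹ over the threefold X = Spec B is isomorphic to 𝔸⁴). If B admits a nontrivial fundamental pair (equivalently, X admits a nontrivial SL₂(k)-action), then B ≅ k^[3] as k-algebras (i.e., X ≅ 𝔸³). -/

import Mathlib

/-- A derivation is locally nilpotent if every element is annihilated by some power. -/
def IsLND {R B : Type*} [CommRing R] [CommRing B] [Algebra R B]
    (D : Derivation R B B) : Prop :=
  ∀ b : B, ∃ n : ℕ, (D.toLinearMap ^ n) b = 0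

/-- The degree-`d` piece `B_d = ker([D,U] - d·id)` of the `ℤ`-grading induced by `(D, U)`. -/
def gradePiece {R B : Type*} [CommRing R] [CommRing B] [Algebra R B]
    (D U : Derivation R B B) (d : ℤ) : Submodule R B :=
  LinearMap.ker ((⁅D, U⁆ : Derivation R B B).toLinearMap
    - d • (LinearMap.id : B →ₗ[R] B))

/-- `(D, U)` is a fundamental pair: both are locally nilpotent, `[D,[D,U]] = -2D`,
`[U,[D,U]] = 2U`, and `B` is the sum of the eigenspaces of `[D,U]`. -/
def IsFundamentalPair {R B : Type*} [CommRing R] [CommRing B] [Algebra R B]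
    (D U : Derivation R B B) : Prop :=
  IsLND D ∧ IsLND U ∧
    ⁅D, ⁅D, U⁆⁆ = (-2 : ℤ) • D ∧
    ⁅U, ⁅D, U⁆⁆ = (2 : ℤ) • U ∧
    (⨆ d : ℤ, gradePiece D U d) = ⊤

/-- A self-map is locally nilpotent if every element is annihilated by some iterate. -/
def LocNil {V : Type*} [Zero V] (f : V → V) : Prop :=
  ∀ v, ∃ n : ℕ, f^[n] v = 0

section Iterate

variable {V : Type*} [AddMonoid V] {f : V → V}

theorem iterate_eq_zero_of_le (hf : f 0 = 0) {v : V} {m n : ℕ} (hmn : m ≤ n)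
    (h : f^[m] v = 0) : f^[n] v = 0 := by
  obtain ⟨j, rfl⟩ := Nat.exists_eq_add_of_le' hmn
  rw [Function.iterate_add_apply, h, Function.iterate_fixed hf]

theorem LocNil.exists_top (hf : LocNil f) {v : V} (hv : v ≠ 0) :
    ∃ n : ℕ, f^[n] v ≠ 0 ∧ f^[n + 1] v = 0 := by
  classical
  have h := hf v
  have h0 : Nat.find h ≠ 0 := fun h0 => hv (by simpa [h0] using Nat.find_spec h)
  obtain ⟨n, hn⟩ := Nat.exists_eq_succ_of_ne_zero h0
  exact ⟨n, Nat.find_min h (by omega), by rw [← Nat.succ_eq_add_one, ← hn]; exact Nat.find_spec h⟩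

end Iterate

namespace Derivation

section LocallyNilpotent

variable {k R : Type*} [CommRing k] [CommRing R] [Algebra k R] (δ : Derivation k R R)

theorem iterate_zero_arg (n : ℕ) : δ^[n] 0 = 0 := Function.iterate_fixed (map_zero δ) n

theorem iterate_mul_top (N : ℕ) : ∀ (m n : ℕ) (a b : R), m + n = N → δ^[m + 1] a = 0 →
    δ^[n + 1] b = 0 → δ^[N] (a * b) = ((m + n).choose m : R) * (δ^[m] a * δ^[n] b) := by
  have hadd : ∀ (n : ℕ) (x y : R), δ^[n] (x + y) = δ^[n] x + δ^[n] y := fun n x y =>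
    iterate_map_add δ n x y
  induction N with
  | zero =>
    intro m n a b h _ _
    obtain ⟨rfl, rfl⟩ : m = 0 ∧ n = 0 := by omega
    simp
  | succ N ih =>
    intro m n a b h ha hb
    rw [Function.iterate_succ_apply, leibniz, smul_eq_mul, smul_eq_mul, hadd]
    rcases m with _ | m <;> rcases n with _ | n
    · omega
    · have ha' : δ a = 0 := ha
      rw [ih 0 n a (δ b) (by omega) ha hb, ha', mul_zero, δ.iterate_zero_arg]
      simp
    · have hb' : δ b = 0 := hb
      rw [mul_comm b, ih m 0 (δ a) b (by omega) ha hb, hb', mul_zero, δ.iterate_zero_arg]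
      simp
    · rw [mul_comm b, ih (m + 1) n a (δ b) (by omega) ha hb,
        ih m (n + 1) (δ a) b (by omega) ha hb,
        show m + 1 + (n + 1) = (m + n + 1) + 1 by ring, Nat.choose_succ_succ',
        show m + 1 + n = m + n + 1 by ring, show m + (n + 1) = m + n + 1 by ring]
      push_cast
      simp only [Function.iterate_succ_apply]
      ring

theorem iterate_mul_of_eq_zero {c : R} (hc : δ c = 0) (n : ℕ) (a : R) :
    δ^[n] (c * a) = c * δ^[n] a := by
  induction n with
  | zero => rfl
  | succ n ih => rw [Function.iterate_succ_apply', ih, Function.iterate_succ_apply']; simp [hc]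

variable [IsDomain R] [CharZero R] {δ}

theorem eq_zero_of_mul (hδ : LocNil δ) {a b : R} (hab : a * b ≠ 0) (h : δ (a * b) = 0) :
    δ a = 0 := by
  obtain ⟨m, hm, hm'⟩ := hδ.exists_top (left_ne_zero_of_mul hab)
  obtain ⟨n, hn, hn'⟩ := hδ.exists_top (right_ne_zero_of_mul hab)
  have key := δ.iterate_mul_top _ m n a b rfl hm' hn'
  rcases m with _ | m
  · simpa using hm'
  · exfalso
    rw [show m + 1 + n = (m + n) + 1 by ring, Function.iterate_succ_apply, h,
      δ.iterate_zero_arg] at key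
    refine mul_ne_zero (Nat.cast_ne_zero.2 (Nat.choose_pos (by omega)).ne') (mul_ne_zero hm hn)
      key.symm

theorem eq_zero_of_dvd (hδ : LocNil δ) {a b : R} (hb : b ≠ 0) (h : δ b = 0) (hab : a ∣ b) :
    δ a = 0 := by
  obtain ⟨c, rfl⟩ := hab
  exact eq_zero_of_mul hδ hb h

/-- An element whose multiplication does not raise the nilpotency index of some nonzero element
is a constant. -/
theorem eq_zero_of_iterate_mul (hδ : LocNil δ) {a c : R} (ha : a ≠ 0) (hc : c ≠ 0)
    (h : ∀ n, δ^[n] a = 0 → δ^[n] (c * a) = 0) : δ c = 0 := by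
  obtain ⟨m, hm, hm'⟩ := hδ.exists_top hc
  obtain ⟨n, hn, hn'⟩ := hδ.exists_top ha
  have key := δ.iterate_mul_top _ m n c a rfl hm' hn'
  rcases m with _ | m
  · simpa using hm'
  · exfalso
    rw [iterate_eq_zero_of_le (map_zero δ) (show n + 1 ≤ m + 1 + n by omega) (h _ hn')] at key
    refine mul_ne_zero (Nat.cast_ne_zero.2 (Nat.choose_pos (by omega)).ne') (mul_ne_zero hm hn)
      key.symm

theorem eq_zero_of_dvd_self (hδ : LocNil δ) {a : R} (h : a ∣ δ a) : δ a = 0 := by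
  by_contra h0
  obtain ⟨c, hc⟩ := h
  have ha : a ≠ 0 := fun h1 => h0 (by rw [h1, map_zero])
  have hc0 : c ≠ 0 := fun h1 => h0 (by rw [hc, h1, mul_zero])
  have hc1 : δ c = 0 := by
    refine eq_zero_of_iterate_mul hδ ha hc0 fun n hn => ?_
    rw [mul_comm, ← hc, ← Function.iterate_succ_apply, Function.iterate_succ_apply', hn, map_zero]
  have h2 : ∀ n, δ^[n] a = c ^ n * a := by
    intro n
    induction n with
    | zero => simp
    | succ n ih =>
      rw [Function.iterate_succ_apply, hc, mul_comm, δ.iterate_mul_of_eq_zero hc1, ih]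
      ring
  obtain ⟨n, hn⟩ := hδ a
  rw [h2] at hn
  exact mul_ne_zero (pow_ne_zero _ hc0) ha hn

end LocallyNilpotent

end Derivation

/-- Three endomorphisms satisfying the bracket relations of the standard basis of `sl₂`. -/
structure IsSl2 {k V : Type*} [Field k] [AddCommGroup V] [Module k V] (D U E : Module.End k V) :
    Prop where
  du : ∀ v, D (U v) = U (D v) + E v
  ed : ∀ v, E (D v) = D (E v) + (2 : k) • D v
  eu : ∀ v, E (U v) = U (E v) - (2 : k) • U v

namespace IsSl2

variable {k V : Type*} [Field k] [AddCommGroup V] [Module k V] {D U E : Module.End k V}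

theorem weight_iterate_U (h : IsSl2 D U E) {v : V} {m : k} (hv : E v = m • v) (j : ℕ) :
    E (U^[j] v) = (m - 2 * j) • U^[j] v := by
  induction j with
  | zero => simpa using hv
  | succ j ih =>
    rw [Function.iterate_succ_apply', h.eu, ih, map_smul]
    push_cast
    module

theorem weight_iterate_D (h : IsSl2 D U E) {v : V} {m : k} (hv : E v = m • v) (j : ℕ) :
    E (D^[j] v) = (m + 2 * j) • D^[j] v := by
  induction j with
  | zero => simpa using hv
  | succ j ih =>
    rw [Function.iterate_succ_apply', h.ed, ih, map_smul]
    push_cast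
    module

theorem D_iterate_U (h : IsSl2 D U E) {v : V} {m : k} (hv : E v = m • v) (j : ℕ) :
    D (U^[j + 1] v) = U^[j + 1] (D v) + ((j + 1) * (m - j)) • U^[j] v := by
  induction j with
  | zero => simp [h.du, hv]
  | succ j ih =>
    rw [Function.iterate_succ_apply', h.du, ih, h.weight_iterate_U hv, map_add, map_smul,
      ← Function.iterate_succ_apply' U j v, ← Function.iterate_succ_apply' U (j + 1) (D v)]
    push_cast
    module

theorem U_iterate_of_highest (h : IsSl2 D U E) {v : V} {m : k} (hv : E v = m • v)
    (hD : D v = 0) (j : ℕ) :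
    D (U^[j + 1] v) = ((j + 1) * (m - j)) • U^[j] v := by
  rw [h.D_iterate_U hv, hD, Function.iterate_fixed (map_zero U), zero_add]

/-- `D^n U^n` acts by a scalar on highest weight vectors. -/
theorem D_iterate_U_iterate (h : IsSl2 D U E) {v : V} {m : k} (hv : E v = m • v)
    (hD : D v = 0) (n : ℕ) :
    D^[n] (U^[n] v) = (∏ j ∈ Finset.range n, ((j + 1 : k) * (m - j))) • v := by
  induction n with
  | zero => simp
  | succ n ih =>
    rw [Function.iterate_succ_apply, h.U_iterate_of_highest hv hD, ← Module.End.pow_apply D,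
      map_smul, Module.End.pow_apply, ih, Finset.prod_range_succ, smul_smul, mul_comm]

variable [CharZero k]

/-- The weight of a highest weight vector is a natural number, and determines the length of its
`U`-string. -/
theorem exists_nat_weight (h : IsSl2 D U E) (hU : LocNil U) {v : V} (hv0 : v ≠ 0) {m : k}
    (hv : E v = m • v) (hD : D v = 0) :
    ∃ n : ℕ, m = n ∧ U^[n + 1] v = 0 := by
  obtain ⟨n, hn, hn'⟩ := hU.exists_top hv0
  have := h.U_iterate_of_highest hv hD n
  rw [hn', map_zero, eq_comm, smul_eq_zero_iff_left hn, mul_eq_zero] at this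
  refine ⟨n, ?_, hn'⟩
  rcases this with h1 | h1
  · exact absurd h1 (by exact_mod_cast n.succ_ne_zero)
  · exact sub_eq_zero.1 h1

theorem U_eq_zero (h : IsSl2 D U E) (hU : LocNil U) {v : V}
    (hv : E v = 0) (hD : D v = 0) : U v = 0 := by
  by_cases hv0 : v = 0
  · simp [hv0]
  obtain ⟨n, hn, hn'⟩ := h.exists_nat_weight hU hv0 (m := 0) (by simpa using hv) hD
  obtain rfl : n = 0 := by exact_mod_cast hn.symm
  simpa using hn'

/-- `D` has no nonzero value of weight zero and killed by `U` on vectors of weight `-2`. -/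
theorem D_eq_zero (h : IsSl2 D U E) (hU : LocNil U) {b : V} (hb : E b = (-2 : k) • b)
    (hUD : U (D b) = 0) : D b = 0 := by
  by_contra hDb
  have key : ∀ j : ℕ, U^[j] b ≠ 0 := by
    intro j
    induction j with
    | zero => rintro rfl; simp at hDb
    | succ j ih =>
      intro h0
      have h1 := h.D_iterate_U hb j
      rw [h0, map_zero, Function.iterate_succ_apply, hUD, Function.iterate_fixed (map_zero U),
        zero_add, eq_comm, smul_eq_zero_iff_left ih, mul_eq_zero] at h1
      rcases h1 with h1 | h1
      · exact absurd h1 (by exact_mod_cast j.succ_ne_zero)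
      · have : ((j + 2 : ℕ) : k) = 0 := by push_cast; linear_combination -h1
        exact absurd this (by exact_mod_cast (j + 1).succ_ne_zero)
  obtain ⟨j, hj⟩ := hU b
  exact key j hj

/-- The projection of a weight zero vector to the invariants. -/
theorem exists_invariant (h : IsSl2 D U E) {v : V} (hv : E v = 0) {N : ℕ} (hN : D^[N] v = 0) :
    ∃ c : ℕ → k, c 0 = 1 ∧
      D (∑ i ∈ Finset.range N, c i • U^[i] (D^[i] v)) = 0 ∧
      E (∑ i ∈ Finset.range N, c i • U^[i] (D^[i] v)) = 0 := by
  let c : ℕ → k := fun i => (-1) ^ i / ((i.factorial : k) * ((i + 1).factorial : k))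
  have hw : ∀ i : ℕ, E (D^[i] v) = (2 * i : k) • D^[i] v := fun i => by
    simpa using h.weight_iterate_D (m := 0) (by simpa using hv) i
  refine ⟨c, by simp [c], ?_, ?_⟩
  · have h1 : ∀ n : ℕ, D (∑ i ∈ Finset.range n, c i • U^[i] (D^[i] v)) =
        (if n = 0 then 0 else c (n - 1)) • U^[n - 1] (D^[n] v) := by
      intro n
      induction n with
      | zero => simp
      | succ n ih =>
        rw [Finset.sum_range_succ, map_add, ih, map_smul]
        rcases n with _ | n
        · simp
        · rw [h.D_iterate_U (hw (n + 1)), ← Function.iterate_succ_apply' D]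
          simp only [Nat.add_one_ne_zero, if_false, Nat.add_sub_cancel]
          have hc : c (n + 1) * ((n + 1) * (2 * ((n + 1 : ℕ) : k) - n)) = - c n := by
            simp only [c, Nat.factorial_succ]
            have e1 : ((n : k) + 1) ≠ 0 := by exact_mod_cast n.succ_ne_zero
            have e2 : ((n : k) + 1 + 1) ≠ 0 := by exact_mod_cast (n + 1).succ_ne_zero
            have e3 : (n.factorial : k) ≠ 0 := by exact_mod_cast n.factorial_ne_zero
            push_cast
            field_simp
            ring
          rw [smul_add, smul_smul, hc]
          module
    rw [h1, hN, Function.iterate_fixed (map_zero U), smul_zero]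
  · rw [map_sum]
    refine Finset.sum_eq_zero fun i _ => ?_
    rw [map_smul, h.weight_iterate_U (hw i), sub_self, zero_smul, smul_zero]

end IsSl2

namespace Derivation

theorem finset_sum_apply {k R M ι : Type*} [CommRing k] [CommRing R] [Algebra k R]
    [AddCommGroup M] [Module k M] [Module R M] (s : Finset ι) (δ : ι → Derivation k R M) (a : R) :
    (∑ i ∈ s, δ i) a = ∑ i ∈ s, δ i a := by
  classical
  induction s using Finset.induction_on with
  | empty => simp
  | insert i s hi ih => simp [Finset.sum_insert hi, ih]

section Det

variable {k R : Type*} [CommRing k] [CommRing R] [Algebra k R]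
  {σ : Type*} [DecidableEq σ]

theorem apply_prod_update (δ : Derivation k R R) (s : Finset σ) (f : σ → R) :
    δ (∏ i ∈ s, f i) = ∑ i ∈ s, ∏ j ∈ s, Function.update f i (δ (f i)) j := by
  induction s using Finset.induction_on with
  | empty => simp
  | insert a s ha ih =>
    rw [Finset.prod_insert ha, leibniz, ih, Finset.sum_insert ha, Finset.prod_insert ha,
      Function.update_self, smul_eq_mul, smul_eq_mul, Finset.mul_sum, add_comm, mul_comm]
    congr 1
    · congr 1
      exact Finset.prod_congr rfl fun j hj =>
        (Function.update_of_ne (ne_of_mem_of_not_mem hj ha) _ _).symm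
    · refine Finset.sum_congr rfl fun i hi => ?_
      rw [Finset.prod_insert ha, Function.update_of_ne (ne_of_mem_of_not_mem hi ha).symm]

theorem apply_det [Fintype σ] (δ : Derivation k R R) (M : Matrix σ σ R) :
    δ M.det = ∑ i, (M.updateRow i (fun j => δ (M i j))).det := by
  have hc : ∀ N : Matrix σ σ R, δ N.det = ∑ i, (N.updateCol i (fun j => δ (N j i))).det := by
    intro N
    simp only [Matrix.det_apply]
    rw [map_sum, Finset.sum_comm]
    refine Finset.sum_congr rfl fun τ _ => ?_
    rw [map_smul_of_tower, apply_prod_update, Finset.smul_sum]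
    refine Finset.sum_congr rfl fun i _ => ?_
    congr 1
    refine Finset.prod_congr rfl fun j _ => ?_
    by_cases h : j = i
    · subst h; simp
    · simp [h]
  rw [← Matrix.det_transpose, hc]
  refine Finset.sum_congr rfl fun i _ => ?_
  rw [← Matrix.det_transpose, ← Matrix.updateRow_transpose]
  rfl

end Det

end Derivation

theorem Matrix.sum_det_updateRow_mul {R σ : Type*} [CommRing R] [Fintype σ] [DecidableEq σ]
    (M N : Matrix σ σ R) :
    ∑ i, (M.updateRow i ((M * N) i)).det = N.trace * M.det := by
  have h1 : ∀ i, (M.updateRow i ((M * N) i)).det = ((M * N) * M.adjugate) i i := by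
    intro i
    rw [← Matrix.cramer_transpose_apply, Matrix.cramer_eq_adjugate_mulVec,
      ← Matrix.adjugate_transpose, Matrix.mulVec_transpose]
    rfl
  simp_rw [h1]
  change Matrix.trace _ = _
  rw [Matrix.mul_assoc, Matrix.trace_mul_comm, Matrix.mul_assoc, Matrix.adjugate_mul,
    Matrix.mul_smul, Matrix.mul_one, Matrix.trace_smul, smul_eq_mul, mul_comm]

namespace MvPolynomial

section Divergence

variable {k σ : Type*} [Field k] [Fintype σ]

/-- The divergence of a derivation of a polynomial ring. -/
noncomputable def divergence :
    Derivation k (MvPolynomial σ k) (MvPolynomial σ k) →ₗ[k] MvPolynomial σ k where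
  toFun δ := ∑ i, pderiv i (δ (X i))
  map_add' := by simp [Finset.sum_add_distrib]
  map_smul' := by simp [Finset.smul_sum]

theorem divergence_apply (δ : Derivation k (MvPolynomial σ k) (MvPolynomial σ k)) :
    divergence δ = ∑ i, pderiv i (δ (X i)) := rfl

variable [DecidableEq σ]

theorem derivation_eq_sum {M : Type*} [AddCommGroup M] [Module k M]
    [Module (MvPolynomial σ k) M] [IsScalarTower k (MvPolynomial σ k) M]
    (δ : Derivation k (MvPolynomial σ k) M) (f : MvPolynomial σ k) :
    δ f = ∑ l, pderiv l f • δ (X l) := by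
  have : δ = ∑ l, (LinearMap.toSpanSingleton (MvPolynomial σ k) M (δ (X l))).compDer
      (pderiv l) := by
    refine derivation_ext fun i => ?_
    rw [Derivation.finset_sum_apply]
    simp [pderiv_X, Pi.single_apply, ite_smul]
  conv_lhs => rw [this]
  rw [Derivation.finset_sum_apply]
  simp

theorem pderiv_derivation (δ : Derivation k (MvPolynomial σ k) (MvPolynomial σ k)) (j : σ)
    (f : MvPolynomial σ k) :
    pderiv j (δ f) = δ (pderiv j f) + ∑ l, pderiv l f * pderiv j (δ (X l)) := by
  have h := derivation_eq_sum ⁅(pderiv j : Derivation k (MvPolynomial σ k) (MvPolynomial σ k)), δ⁆ f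
  simp only [Derivation.commutator_apply, smul_eq_mul] at h
  rw [eq_add_of_sub_eq h, add_comm]
  congr 1
  refine Finset.sum_congr rfl fun l _ => ?_
  rw [pderiv_X, Pi.single_apply]
  split_ifs <;> simp

theorem divergence_lie (δ₁ δ₂ : Derivation k (MvPolynomial σ k) (MvPolynomial σ k)) :
    divergence ⁅δ₁, δ₂⁆ = δ₁ (divergence δ₂) - δ₂ (divergence δ₁) := by
  have h : ∀ δ₁ δ₂ : Derivation k (MvPolynomial σ k) (MvPolynomial σ k),
      ∑ i, pderiv i (δ₁ (δ₂ (X i))) = δ₁ (divergence δ₂) +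
        ∑ i, ∑ l, pderiv l (δ₂ (X i)) * pderiv i (δ₁ (X l)) := fun δ₁ δ₂ => by
    rw [divergence_apply, map_sum, ← Finset.sum_add_distrib]
    exact Finset.sum_congr rfl fun i _ => pderiv_derivation δ₁ i _
  rw [divergence_apply]
  simp only [Derivation.commutator_apply, map_sub, Finset.sum_sub_distrib]
  rw [h, h, Finset.sum_comm]
  simp only [mul_comm]
  abel

theorem divergence_smul (b : MvPolynomial σ k)
    (δ : Derivation k (MvPolynomial σ k) (MvPolynomial σ k)) :
    divergence (b • δ) = b * divergence δ + δ b := by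
  simp only [divergence_apply, Derivation.smul_apply, smul_eq_mul, Derivation.leibniz,
    Finset.sum_add_distrib, Finset.mul_sum]
  rw [derivation_eq_sum δ b]
  simp [mul_comm]

/-- The Jacobian determinant of a family of polynomials. -/
noncomputable def jacobian (g : σ → MvPolynomial σ k) : MvPolynomial σ k :=
  (Matrix.of fun i j => pderiv j (g i)).det

theorem jacobian_update (g : σ → MvPolynomial σ k) (i : σ) (f : MvPolynomial σ k) :
    jacobian (Function.update g i f) =
      ((Matrix.of fun i j => pderiv j (g i)).updateRow i fun j => pderiv j f).det := by
  unfold jacobian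
  congr 1
  ext a b
  by_cases h : a = i
  · subst h; simp
  · simp [h]

/-- The Jacobian determinant as a derivation in its `i`-th argument. -/
noncomputable def jacobianDerivation (g : σ → MvPolynomial σ k) (i : σ) :
    Derivation k (MvPolynomial σ k) (MvPolynomial σ k) :=
  ∑ j, (Matrix.of fun i j => pderiv j (g i)).adjugate j i • pderiv j

theorem jacobianDerivation_apply (g : σ → MvPolynomial σ k) (i : σ) (f : MvPolynomial σ k) :
    jacobianDerivation g i f = jacobian (Function.update g i f) := by
  rw [jacobian_update, ← Matrix.cramer_transpose_apply, Matrix.cramer_eq_adjugate_mulVec,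
    ← Matrix.adjugate_transpose, Matrix.mulVec_transpose, jacobianDerivation,
    Derivation.finset_sum_apply]
  simp [Matrix.vecMul, dotProduct, mul_comm]

theorem jacobianDerivation_self (g : σ → MvPolynomial σ k) (i : σ) :
    jacobianDerivation g i (g i) = jacobian g := by
  rw [jacobianDerivation_apply, Function.update_eq_self]

theorem jacobianDerivation_of_ne (g : σ → MvPolynomial σ k) {i j : σ} (h : j ≠ i) :
    jacobianDerivation g i (g j) = 0 := by
  rw [jacobianDerivation_apply]
  refine Matrix.det_zero_of_row_eq h ?_
  ext l
  simp [h]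

theorem jacobian_X : jacobian (fun i : σ => (X i : MvPolynomial σ k)) = 1 := by
  unfold jacobian
  rw [← Matrix.det_one (n := σ) (R := MvPolynomial σ k)]
  congr 1
  ext i j
  simp [pderiv_X, Matrix.one_apply, Pi.single_apply]

theorem jacobian_eq_zero (g : σ → MvPolynomial σ k) (i : σ) (h : ∀ j, pderiv j (g i) = 0) :
    jacobian g = 0 :=
  Matrix.det_eq_zero_of_row_eq_zero i fun j => by simp [h]

/-- The Lie derivative of a Jacobian determinant. -/
theorem derivation_jacobian (δ : Derivation k (MvPolynomial σ k) (MvPolynomial σ k))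
    (g : σ → MvPolynomial σ k) :
    δ (jacobian g) + divergence δ * jacobian g =
      ∑ i, jacobian (Function.update g i (δ (g i))) := by
  let M : Matrix σ σ (MvPolynomial σ k) := Matrix.of fun i j => pderiv j (g i)
  let N : Matrix σ σ (MvPolynomial σ k) := Matrix.of fun l j => pderiv j (δ (X l))
  have hN : N.trace = divergence δ := rfl
  rw [← hN]
  change δ M.det + N.trace * M.det = _
  rw [Derivation.apply_det, ← Matrix.sum_det_updateRow_mul, ← Finset.sum_add_distrib]
  refine Finset.sum_congr rfl fun i _ => ?_
  rw [jacobian_update, ← Matrix.det_updateRow_add]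
  congr 2
  ext j : 1
  rw [pderiv_derivation δ]
  simp [M, N, Matrix.mul_apply]

/-- The derivative of the determinant of a family of derivations. -/
theorem derivation_det_derivations
    (Δ : Derivation k (MvPolynomial σ k) (MvPolynomial σ k))
    (δ : σ → Derivation k (MvPolynomial σ k) (MvPolynomial σ k)) :
    Δ (Matrix.of fun i j => δ i (X j)).det =
      divergence Δ * (Matrix.of fun i j => δ i (X j)).det +
      ∑ i, (Matrix.of fun a j => Function.update δ i ⁅Δ, δ i⁆ a (X j)).det := by
  let M : Matrix σ σ (MvPolynomial σ k) := Matrix.of fun i j => δ i (X j)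
  let N : Matrix σ σ (MvPolynomial σ k) := Matrix.of fun l j => pderiv l (Δ (X j))
  have hN : N.trace = divergence Δ := rfl
  rw [← hN]
  change Δ M.det = N.trace * M.det + _
  rw [Derivation.apply_det, ← Matrix.sum_det_updateRow_mul, ← Finset.sum_add_distrib]
  refine Finset.sum_congr rfl fun i _ => ?_
  have : (Matrix.of fun a j => Function.update δ i ⁅Δ, δ i⁆ a (X j)) =
      M.updateRow i fun j => ⁅Δ, δ i⁆ (X j) := by
    ext a j
    by_cases h : a = i
    · subst h; simp
    · simp [h, M]
  rw [this, ← Matrix.det_updateRow_add]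
  congr 2
  ext j : 1
  simp [M, N, Matrix.mul_apply, Derivation.commutator_apply, derivation_eq_sum (δ i) (Δ (X j)),
    mul_comm]

theorem divergence_eq_zero [CharZero k]
    {δ : Derivation k (MvPolynomial σ k) (MvPolynomial σ k)} (hδ : LocNil δ) :
    divergence δ = 0 := by
  let u := divergence δ
  let L : Module.End k (MvPolynomial σ k) := δ.toLinearMap + LinearMap.mulLeft k u
  have hL : ∀ f, L f = δ f + u * f := fun _ => rfl
  have key : ∀ (N : ℕ) (g : σ → MvPolynomial σ k) (n : σ → ℕ), ∑ i, n i ≤ N →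
      (∀ i, δ^[n i] (g i) = 0) → L^[N + 1] (jacobian g) = 0 := by
    intro N
    induction N with
    | zero =>
      intro g n hn hg
      rw [Nat.zero_add, Function.iterate_one, hL, derivation_jacobian]
      refine Finset.sum_eq_zero fun i _ => jacobian_eq_zero _ i fun j => ?_
      have h0 : n i = 0 := by
        have := Finset.single_le_sum (f := n) (fun _ _ => Nat.zero_le _) (Finset.mem_univ i)
        omega
      have := hg i
      rw [h0, Function.iterate_zero, id] at this
      simp [this]
    | succ N ih =>
      intro g n hn hg
      rw [Function.iterate_succ_apply, hL, derivation_jacobian, ← Module.End.pow_apply, map_sum]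
      refine Finset.sum_eq_zero fun i _ => ?_
      rw [Module.End.pow_apply]
      rcases Nat.eq_zero_or_pos (n i) with h0 | hpos
      · have := hg i
        rw [h0, Function.iterate_zero, id] at this
        rw [jacobian_eq_zero _ i fun j => by simp [this], Function.iterate_fixed (map_zero L)]
      · refine ih _ (Function.update n i (n i - 1)) ?_ fun j => ?_
        · rw [Finset.sum_update_of_mem (Finset.mem_univ i)]
          have := Finset.sum_erase_add Finset.univ n (Finset.mem_univ i)
          rw [← Finset.erase_eq] at *
          omega
        · by_cases h : j = i
          · subst h
            rw [Function.update_self, Function.update_self, ← Function.iterate_succ_apply,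
              show (n j - 1).succ = n j by omega, hg]
          · rw [Function.update_of_ne h, Function.update_of_ne h, hg]
  choose n hn using fun i => hδ (X i : MvPolynomial σ k)
  have h1 := key _ (fun i => X i) n le_rfl hn
  rw [jacobian_X] at h1
  classical
  have hex : ∃ m, L^[m] 1 = 0 := ⟨_, h1⟩
  have h0 : Nat.find hex ≠ 0 := fun h0 =>
    one_ne_zero (α := MvPolynomial σ k) (by simpa [h0] using Nat.find_spec hex)
  obtain ⟨m, hm⟩ := Nat.exists_eq_succ_of_ne_zero h0
  have hne := Nat.find_min hex (m := m) (by omega)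
  have hz := Nat.find_spec hex
  rw [hm, Function.iterate_succ_apply', hL] at hz
  have hd : δ (L^[m] 1) = 0 :=
    Derivation.eq_zero_of_dvd_self hδ ⟨-u, by linear_combination hz⟩
  rw [hd, zero_add] at hz
  exact (mul_eq_zero.1 hz).resolve_right hne

end Divergence

end MvPolynomial

namespace MvPolynomial

section Euler

variable {k σ : Type*} [Field k]

/-- The Euler derivation. -/
noncomputable def euler : Derivation k (MvPolynomial σ k) (MvPolynomial σ k) :=
  mkDerivation k X

theorem euler_X (i : σ) : euler (X i : MvPolynomial σ k) = X i := mkDerivation_X _ _ _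

theorem euler_monomial (s : σ →₀ ℕ) (r : k) :
    euler (monomial s r) = (s.degree : k) • monomial s r := by
  have hs : s.degree = ∑ i ∈ s.support, s i := rfl
  rw [euler, mkDerivation_monomial, Finsupp.sum, hs, Nat.cast_sum, Finset.sum_smul,
    Finset.smul_sum]
  refine Finset.sum_congr rfl fun i hi => ?_
  have : s - Finsupp.single i 1 + Finsupp.single i 1 = s :=
    tsub_add_cancel_of_le (Finsupp.single_le_iff.2
      (Nat.one_le_iff_ne_zero.2 (Finsupp.mem_support_iff.1 hi)))
  rw [X, smul_eq_mul, monomial_mul, this, smul_monomial, smul_monomial]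
  simp [mul_comm]

/-- The inverse of `euler + c`. -/
noncomputable def eulerInv (c : ℕ) : MvPolynomial σ k →ₗ[k] MvPolynomial σ k :=
  (basisMonomials σ k).constr k fun s => monomial s ((s.degree + c : k)⁻¹)

theorem eulerInv_monomial (c : ℕ) (s : σ →₀ ℕ) :
    eulerInv c (monomial s (1 : k)) = monomial s ((s.degree + c : k)⁻¹) := by
  have := (basisMonomials σ k).constr_basis k (fun s => monomial s ((s.degree + c : k)⁻¹)) s
  simpa [eulerInv] using this

theorem divergence_euler [Fintype σ] :
    divergence (euler : Derivation k (MvPolynomial σ k) _) = (Fintype.card σ : MvPolynomial σ k) := by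
  classical
  simp [divergence_apply, euler_X]

variable [CharZero k]

theorem euler_add_eulerInv {c : ℕ} (hc : c ≠ 0) (f : MvPolynomial σ k) :
    euler (eulerInv c f) + (c : k) • eulerInv c f = f := by
  have : (euler.toLinearMap ∘ₗ eulerInv c + (c : k) • eulerInv c :
      MvPolynomial σ k →ₗ[k] MvPolynomial σ k) = LinearMap.id := by
    refine (basisMonomials σ k).ext fun s => ?_
    have h0 : (s.degree + c : k) ≠ 0 := by exact_mod_cast (by omega : s.degree + c ≠ 0)
    simp only [coe_basisMonomials, LinearMap.add_apply, LinearMap.comp_apply, LinearMap.smul_apply,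
      eulerInv_monomial, Derivation.coeFn_coe, euler_monomial, LinearMap.id_apply]
    rw [← add_smul, smul_monomial, smul_eq_mul, mul_inv_cancel₀ h0]
  exact LinearMap.congr_fun this f

theorem eq_zero_of_euler_add {c : ℕ} (hc : c ≠ 0) {f : MvPolynomial σ k}
    (h : euler f + (c : k) • f = 0) : f = 0 := by
  have : (eulerInv c ∘ₗ (euler.toLinearMap + (c : k) • LinearMap.id) :
      MvPolynomial σ k →ₗ[k] MvPolynomial σ k) = LinearMap.id := by
    refine (basisMonomials σ k).ext fun s => ?_
    have h0 : (s.degree + c : k) ≠ 0 := by exact_mod_cast (by omega : s.degree + c ≠ 0)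
    simp only [coe_basisMonomials, LinearMap.add_apply, LinearMap.comp_apply, LinearMap.smul_apply,
      Derivation.coeFn_coe, euler_monomial, LinearMap.id_apply]
    rw [← add_smul, map_smul, eulerInv_monomial, smul_monomial, smul_eq_mul, mul_inv_cancel₀ h0]
  have h2 := LinearMap.congr_fun this f
  rw [LinearMap.id_apply] at h2
  rw [← h2]
  change eulerInv c (euler f + (c : k) • f) = 0
  rw [h, map_zero]

/-- A derivation with a slice `t` and zero divergence on a polynomial ring in at least two
variables yields a derivation of divergence one killing `t`. -/
theorem exists_divergence_one [Fintype σ] (hσ : 2 ≤ Fintype.card σ)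
    (T : Derivation k (MvPolynomial σ k) (MvPolynomial σ k)) (hT : divergence T = 0)
    {t : MvPolynomial σ k} (ht : T t = 1) :
    ∃ Δ : Derivation k (MvPolynomial σ k) (MvPolynomial σ k), Δ t = 0 ∧ divergence Δ = 1 := by
  classical
  obtain ⟨c, hc⟩ : ∃ c, Fintype.card σ = c + 1 := ⟨Fintype.card σ - 1, by omega⟩
  let d : Derivation k (MvPolynomial σ k) (MvPolynomial σ k) :=
    mkDerivation k fun i => eulerInv c (T (X i))
  have hd : ⁅(euler : Derivation k (MvPolynomial σ k) (MvPolynomial σ k)), d⁆ + ((c + 1 : ℕ) : k) • d = T := by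
    refine derivation_ext (R := k) fun i => ?_
    conv_rhs => rw [← euler_add_eulerInv (show c ≠ 0 by omega) (T (X i))]
    simp only [Derivation.add_apply, Derivation.commutator_apply, Derivation.smul_apply, euler_X]
    rw [show d (X i) = eulerInv c (T (X i)) from mkDerivation_X _ _ _]
    push_cast
    module
  have hdiv : divergence d = 0 := by
    refine eq_zero_of_euler_add (c := c + 1) (by omega) ?_
    have := congrArg divergence hd
    rwa [map_add, map_smul, divergence_lie, divergence_euler, Derivation.map_natCast, sub_zero,
      hT] at this
  refine ⟨d t • euler - euler t • d, ?_, ?_⟩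
  · simp [mul_comm]
  · have h1 : euler (d t) - d (euler t) + ((c + 1 : ℕ) : k) • d t = 1 := by
      rw [← ht, ← hd]; rfl
    rw [map_sub, divergence_smul, divergence_smul, divergence_euler, hdiv, hc]
    rw [Algebra.smul_def] at h1
    push_cast at h1 ⊢
    linear_combination h1

end Euler

end MvPolynomial

/-- An `sl₂`-action by derivations with integral weights, together with a commuting locally
nilpotent derivation `T` and an invariant slice `t` of `T`. -/
structure IsSl2Cylinder {k R : Type*} [Field k] [CommRing R] [Algebra k R]
    (D U E T : Derivation k R R) (t : R) : Prop where
  du : ∀ v, D (U v) = U (D v) + E v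
  ed : ∀ v, E (D v) = D (E v) + (2 : k) • D v
  eu : ∀ v, E (U v) = U (E v) - (2 : k) • U v
  locNil_D : LocNil D
  locNil_U : LocNil U
  locNil_T : LocNil T
  dT : ∀ v, D (T v) = T (D v)
  uT : ∀ v, U (T v) = T (U v)
  T_t : T t = 1
  D_t : D t = 0
  U_t : U t = 0
  weights : ⨆ d : ℤ, Module.End.eigenspace E.toLinearMap (d : k) = ⊤

namespace IsSl2Cylinder

section Basic

variable {k R : Type*} [Field k] [CommRing R] [Algebra k R] {D U E T : Derivation k R R} {t : R}

theorem isSl2 (h : IsSl2Cylinder D U E T t) :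
    IsSl2 (D : Module.End k R) (U : Module.End k R) (E : Module.End k R) :=
  ⟨h.du, h.ed, h.eu⟩

theorem E_eq (h : IsSl2Cylinder D U E T t) (v : R) : E v = D (U v) - U (D v) := by
  rw [h.du]; ring

theorem E_t (h : IsSl2Cylinder D U E T t) : E t = 0 := by
  simp [h.E_eq, h.D_t, h.U_t]

theorem eT (h : IsSl2Cylinder D U E T t) (v : R) : E (T v) = T (E v) := by
  simp [h.E_eq, h.dT, h.uT]

theorem weight_induction (h : IsSl2Cylinder D U E T t) {p : R → Prop}
    (hom : ∀ (d : ℤ) (v : R), E v = (d : k) • v → p v) (add : ∀ v w, p v → p w → p (v + w))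
    (v : R) : p v := by
  have hv : v ∈ ⨆ d : ℤ, Module.End.eigenspace E.toLinearMap (d : k) := by
    rw [h.weights]; trivial
  exact Submodule.iSup_induction (motive := p) _ hv
    (fun d w hw => hom d w (Module.End.mem_eigenspace_iff.1 hw))
    (hom 0 0 (by simp)) add

theorem symm (h : IsSl2Cylinder D U E T t) : IsSl2Cylinder U D (-E) T t where
  du v := by simp [h.du]
  ed v := by simp only [Derivation.neg_apply, h.eu, map_neg]; abel
  eu v := by simp only [Derivation.neg_apply, h.ed, map_neg]; abel
  locNil_D := h.locNil_U
  locNil_U := h.locNil_D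
  locNil_T := h.locNil_T
  dT := h.uT
  uT := h.dT
  T_t := h.T_t
  D_t := h.U_t
  U_t := h.D_t
  weights := by
    rw [eq_top_iff]
    rintro v -
    refine h.weight_induction (fun d v hv => ?_) (fun v w => Submodule.add_mem _) v
    refine Submodule.mem_iSup_of_mem (-d) (Module.End.mem_eigenspace_iff.2 ?_)
    change -E v = _
    rw [hv]
    push_cast
    rw [neg_smul]

end Basic

end IsSl2Cylinder

namespace Derivation

section Ad

variable {k σ : Type*} [Field k]

/-- The adjoint action of a derivation on derivations. -/
noncomputable def adj (δ : Derivation k (MvPolynomial σ k) (MvPolynomial σ k)) : Module.End k (Derivation k (MvPolynomial σ k) (MvPolynomial σ k)) := LieAlgebra.ad k (Derivation k (MvPolynomial σ k) (MvPolynomial σ k)) δ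

theorem adj_apply (δ ε : Derivation k (MvPolynomial σ k) (MvPolynomial σ k)) (a : MvPolynomial σ k) : adj δ ε a = δ (ε a) - ε (δ a) := commutator_apply _

theorem adj_lie (δ ε : Derivation k (MvPolynomial σ k) (MvPolynomial σ k)) : adj δ ε = ⁅δ, ε⁆ := rfl

theorem exists_adj_iterate_apply_eq_zero {δ : Derivation k (MvPolynomial σ k) (MvPolynomial σ k)} (hδ : LocNil δ) (ε : Derivation k (MvPolynomial σ k) (MvPolynomial σ k)) (m : ℕ) :
    ∀ a : MvPolynomial σ k, δ^[m] a = 0 → ∃ N, ∀ n, N ≤ n → (adj δ)^[n] ε a = 0 := by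
  induction m with
  | zero => intro a ha; exact ⟨0, fun n _ => by rw [show a = 0 from ha, map_zero]⟩
  | succ m ih =>
    intro a ha
    obtain ⟨N, hN⟩ := ih (δ a) ha
    have h1 : ∀ j, (adj δ)^[N + j] ε a = δ^[j] ((adj δ)^[N] ε a) := by
      intro j
      induction j with
      | zero => rfl
      | succ j ihj =>
        rw [← add_assoc, Function.iterate_succ_apply', adj_apply, ihj, hN _ (by omega), sub_zero,
          Function.iterate_succ_apply']
    obtain ⟨M, hM⟩ := hδ ((adj δ)^[N] ε a)
    refine ⟨N + M, fun n hn => ?_⟩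
    obtain ⟨j, rfl⟩ := Nat.exists_eq_add_of_le (show N ≤ n by omega)
    rw [h1]
    exact iterate_eq_zero_of_le (map_zero δ) (by omega) hM

theorem locNil_adj [Finite σ] {δ : Derivation k (MvPolynomial σ k) (MvPolynomial σ k)} (hδ : LocNil δ) : LocNil (adj δ) := by
  cases nonempty_fintype σ
  intro ε
  choose m hm using fun i => hδ (MvPolynomial.X i : MvPolynomial σ k)
  choose N hN using fun i => exists_adj_iterate_apply_eq_zero hδ ε (m i) _ (hm i)
  refine ⟨Finset.univ.sup N, MvPolynomial.derivation_ext fun i => ?_⟩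
  rw [hN i _ (Finset.le_sup (Finset.mem_univ i))]
  rfl

theorem divergence_adj [Fintype σ] [DecidableEq σ] {δ : Derivation k (MvPolynomial σ k) (MvPolynomial σ k)}
    (hδ : MvPolynomial.divergence δ = 0) (ε : Derivation k (MvPolynomial σ k) (MvPolynomial σ k)) :
    MvPolynomial.divergence (adj δ ε) = δ (MvPolynomial.divergence ε) := by
  rw [adj_lie, MvPolynomial.divergence_lie, hδ, map_zero, sub_zero]

end Ad

end Derivation

theorem LinearMap.aeval_intertwine {k V W : Type*} [Field k] [AddCommGroup V] [Module k V]
    [AddCommGroup W] [Module k W] {A : Module.End k V} {B : Module.End k W} {φ : V →ₗ[k] W}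
    (h : ∀ v, φ (A v) = B (φ v)) (q : Polynomial k) (v : V) :
    φ (Polynomial.aeval A q v) = Polynomial.aeval B q (φ v) := by
  induction q using Polynomial.induction_on' generalizing v with
  | add p q hp hq => simp [hp, hq]
  | monomial n a =>
    have : ∀ n : ℕ, φ ((A ^ n) v) = (B ^ n) (φ v) := by
      intro n
      induction n with
      | zero => rfl
      | succ n ih => rw [pow_succ', Module.End.mul_apply, h, ih, pow_succ', Module.End.mul_apply]
    simp [Polynomial.aeval_monomial, Module.algebraMap_end_apply, this]

namespace IsSl2Cylinder

open MvPolynomial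

section Equivariant

variable {k σ : Type*} [Field k]


variable {D U E T : Derivation k (MvPolynomial σ k) (MvPolynomial σ k)} {t : MvPolynomial σ k}

theorem isSl2_adj (h : IsSl2Cylinder D U E T t) : IsSl2 (Derivation.adj D) (Derivation.adj U) (Derivation.adj E) where
  du v := by
    refine Derivation.ext fun i => ?_
    simp only [Derivation.add_apply, Derivation.adj_apply, map_sub, h.E_eq]
    ring
  ed v := by
    refine Derivation.ext fun i => ?_
    simp only [Derivation.add_apply, Derivation.smul_apply, Derivation.adj_apply, map_sub, h.ed, map_add,
      Derivation.map_smul, smul_sub]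
    abel_nf
  eu v := by
    refine Derivation.ext fun i => ?_
    simp only [Derivation.sub_apply, Derivation.smul_apply, Derivation.adj_apply, map_sub, h.eu, map_add,
      Derivation.map_smul, smul_sub]
    abel_nf

theorem exists_weight_zero [Finite σ] [CharZero k] (h : IsSl2Cylinder D U E T t) (Δ : Derivation k (MvPolynomial σ k) (MvPolynomial σ k)) :
    ∃ q : Polynomial k, q.eval 0 ≠ 0 ∧ Derivation.adj E (Polynomial.aeval (Derivation.adj E) q Δ) = 0 := by
  cases nonempty_fintype σ
  have key : ∀ b : MvPolynomial σ k, ∃ q : Polynomial k, q.eval 0 ≠ 0 ∧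
      ∀ r, Polynomial.aeval (Derivation.adj E) (r * q * Polynomial.X) Δ b = 0 := by
    have hom : ∀ (d : ℤ) (v : MvPolynomial σ k), E v = (d : k) • v → ∀ w : MvPolynomial σ k, ∃ q : Polynomial k, q.eval 0 ≠ 0 ∧
        Polynomial.aeval (E.toLinearMap - (d : k) • LinearMap.id : Module.End k (MvPolynomial σ k))
          (q * Polynomial.X) w = 0 := by
      intro d v hv w
      refine h.weight_induction (p := fun w => ∃ q : Polynomial k, q.eval 0 ≠ 0 ∧
        Polynomial.aeval (E.toLinearMap - (d : k) • LinearMap.id : Module.End k (MvPolynomial σ k))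
          (q * Polynomial.X) w = 0) (fun e w hw => ?_) (fun w₁ w₂ h₁ h₂ => ?_) w
      · have hB : ((E.toLinearMap - (d : k) • LinearMap.id : Module.End k (MvPolynomial σ k))) w
            = ((e - d : ℤ) : k) • w := by
          change E w - (d : k) • w = _
          rw [hw]
          push_cast
          module
        by_cases hed : e = d
        · refine ⟨1, by simp, ?_⟩
          rw [one_mul, Polynomial.aeval_X, hB, hed]
          simp
        · refine ⟨Polynomial.X - Polynomial.C ((e - d : ℤ) : k), ?_, ?_⟩
          · have : ((e - d : ℤ) : k) ≠ 0 := Int.cast_ne_zero.2 (sub_ne_zero.2 hed)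
            simpa [sub_eq_zero, eq_comm] using this
          · rw [mul_comm, map_mul, Module.End.mul_apply, map_sub, Polynomial.aeval_X,
              Polynomial.aeval_C, LinearMap.sub_apply (_ - _), hB, Module.algebraMap_end_apply,
              sub_self, map_zero]
      · obtain ⟨q₁, hq₁, hz₁⟩ := h₁
        obtain ⟨q₂, hq₂, hz₂⟩ := h₂
        refine ⟨q₁ * q₂, by simp [hq₁, hq₂], ?_⟩
        rw [map_add, show q₁ * q₂ * Polynomial.X = q₂ * (q₁ * Polynomial.X) by ring,
          map_mul _ q₂, Module.End.mul_apply, hz₁, map_zero, zero_add, ← map_mul,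
          show q₂ * (q₁ * Polynomial.X) = q₁ * (q₂ * Polynomial.X) by ring, map_mul _ q₁,
          Module.End.mul_apply, hz₂, map_zero]
    intro b
    refine h.weight_induction (p := fun b => ∃ q : Polynomial k, q.eval 0 ≠ 0 ∧
      ∀ r, Polynomial.aeval (Derivation.adj E) (r * q * Polynomial.X) Δ b = 0)
      (fun d v hv => ?_) (fun v w hv hw => ?_) b
    · obtain ⟨q, hq, hz⟩ := hom d v hv (Δ v)
      refine ⟨q, hq, fun r => ?_⟩
      let φ : Derivation k (MvPolynomial σ k) (MvPolynomial σ k) →ₗ[k] MvPolynomial σ k :=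
        { toFun := fun δ => δ v, map_add' := fun _ _ => rfl, map_smul' := fun _ _ => rfl }
      have := LinearMap.aeval_intertwine (A := Derivation.adj E)
        (B := (E.toLinearMap - (d : k) • LinearMap.id : Module.End k (MvPolynomial σ k))) (φ := φ) (fun δ => by
          change Derivation.adj E δ v = E (δ v) - (d : k) • δ v
          rw [Derivation.adj_apply, hv, Derivation.map_smul]) (r * q * Polynomial.X) Δ
      change φ _ = 0
      rw [this, mul_assoc, map_mul, Module.End.mul_apply]
      rw [show φ Δ = Δ v from rfl, hz, map_zero]
    · obtain ⟨q₁, hq₁, hz₁⟩ := hv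
      obtain ⟨q₂, hq₂, hz₂⟩ := hw
      refine ⟨q₁ * q₂, by simp [hq₁, hq₂], fun r => ?_⟩
      rw [map_add, ← mul_assoc r, hz₂, mul_right_comm r, hz₁, add_zero]
  choose q hq hz using fun i => key (X i : MvPolynomial σ k)
  refine ⟨∏ i, q i, ?_, ?_⟩
  · rw [Polynomial.eval_prod]
    exact Finset.prod_ne_zero_iff.2 fun i _ => hq i
  · refine derivation_ext fun i => ?_
    classical
    have := hz i (∏ j ∈ Finset.univ.erase i, q j)
    rw [Finset.prod_erase_mul _ _ (Finset.mem_univ i), mul_comm, map_mul, Polynomial.aeval_X,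
      Module.End.mul_apply] at this
    rw [this]
    rfl

/-- A derivation of divergence one killing the slice can be made to commute with the action. -/
theorem exists_equivariant [Fintype σ] [CharZero k] (hσ : 2 ≤ Fintype.card σ)
    (h : IsSl2Cylinder D U E T t) :
    ∃ Δ : Derivation k (MvPolynomial σ k) (MvPolynomial σ k), Δ t = 0 ∧ divergence Δ = 1 ∧ (∀ v, Δ (D v) = D (Δ v)) ∧
      (∀ v, Δ (U v) = U (Δ v)) ∧ (∀ v, Δ (T v) = T (Δ v)) := by
  classical
  have divD := divergence_eq_zero h.locNil_D
  have divU := divergence_eq_zero h.locNil_U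
  have divT := divergence_eq_zero h.locNil_T
  have divE : divergence E = 0 := by
    have : E = ⁅D, U⁆ := Derivation.ext fun i => by rw [h.E_eq, Derivation.commutator_apply]
    rw [this, divergence_lie, divD, divU]; simp
  -- the derivations killing `t` and commuting with `T`
  obtain ⟨Δ₀, h₀t, h₀⟩ := exists_divergence_one hσ T divT h.T_t
  have step₁ : ∃ Δ : Derivation k (MvPolynomial σ k) (MvPolynomial σ k), Δ t = 0 ∧ divergence Δ = 1 ∧ Derivation.adj T Δ = 0 := by
    obtain ⟨N, hN⟩ := Derivation.locNil_adj h.locNil_T Δ₀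
    let ε : ℕ → Derivation k (MvPolynomial σ k) (MvPolynomial σ k) := fun i => (Derivation.adj T)^[i] Δ₀
    have hε : ∀ i, Derivation.adj T (ε i) = ε (i + 1) := fun i => (Function.iterate_succ_apply' _ _ _).symm
    have hεt : ∀ i, ε i t = 0 := by
      intro i
      induction i with
      | zero => exact h₀t
      | succ i ih => rw [← hε, Derivation.adj_apply, ih, h.T_t, map_zero, Derivation.map_one_eq_zero, sub_zero]
    have hεd : ∀ i, divergence (ε (i + 1)) = 0 := by
      intro i
      induction i with
      | zero => rw [← hε, Derivation.divergence_adj divT, show ε 0 = Δ₀ from rfl, h₀, Derivation.map_one_eq_zero]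
      | succ i ih => rw [← hε, Derivation.divergence_adj divT, ih, map_zero]
    let c : ℕ → k := fun i => (-1) ^ i / (i.factorial : k)
    have hsum : ∀ n : ℕ, Derivation.adj T (∑ i ∈ Finset.range (n + 1), c i • t ^ i • ε i) =
        c n • t ^ n • ε (n + 1) := by
      have hone : ∀ i, Derivation.adj T (t ^ i • ε i) = (i * t ^ (i - 1)) • ε i + t ^ i • ε (i + 1) := by
        intro i
        refine Derivation.ext fun j => ?_
        rw [Derivation.adj_apply, ← hε]
        simp only [Derivation.add_apply, Derivation.smul_apply, smul_eq_mul, Derivation.leibniz, Derivation.leibniz_pow,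
          Derivation.adj_apply, h.T_t]
        simp
        ring
      intro n
      induction n with
      | zero => simp [c, hε]
      | succ n ih =>
        rw [Finset.sum_range_succ, map_add, ih, map_smul, hone]
        have hc : c (n + 1) * ((n + 1 : ℕ) : k) = - c n := by
          simp only [c, Nat.factorial_succ]
          have e1 : ((n : k) + 1) ≠ 0 := by exact_mod_cast n.succ_ne_zero
          have e3 : (n.factorial : k) ≠ 0 := by exact_mod_cast n.factorial_ne_zero
          push_cast
          field_simp
          ring
        have : c (n + 1) • ((((n + 1 : ℕ) : MvPolynomial σ k) * t ^ (n + 1 - 1)) • ε (n + 1)) =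
            (c (n + 1) * ((n + 1 : ℕ) : k)) • t ^ n • ε (n + 1) := by
          rw [Nat.add_sub_cancel, mul_smul, mul_smul, Nat.cast_smul_eq_nsmul,
            Nat.cast_smul_eq_nsmul]
        rw [smul_add, this, hc]
        module
    refine ⟨∑ i ∈ Finset.range (N + 1), c i • t ^ i • ε i, ?_, ?_, ?_⟩
    · rw [Derivation.finset_sum_apply]
      exact Finset.sum_eq_zero fun i _ => by simp [hεt]
    · rw [map_sum, Finset.sum_range_succ', Finset.sum_eq_zero, zero_add]
      · simp [c, ε, h₀]
      · intro i _
        rw [map_smul, divergence_smul, hεd, Derivation.leibniz_pow, hεt]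
        simp
    · rw [hsum, show ε (N + 1) = 0 from iterate_eq_zero_of_le (map_zero _) (Nat.le_succ N) hN]
      simp
  obtain ⟨Δ₁, h₁t, h₁, h₁T⟩ := step₁
  let W : Submodule k (Derivation k (MvPolynomial σ k) (MvPolynomial σ k)) :=
    { carrier := {δ | δ t = 0 ∧ Derivation.adj T δ = 0}
      add_mem' := fun {a b} ha hb => ⟨by simp [ha.1, hb.1], by rw [map_add, ha.2, hb.2, add_zero]⟩
      zero_mem' := ⟨rfl, map_zero _⟩
      smul_mem' := fun c a ha => ⟨by simp [ha.1], by rw [map_smul, ha.2, smul_zero]⟩ }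
  have hW : ∀ δ : Derivation k (MvPolynomial σ k) (MvPolynomial σ k), δ t = 0 → (∀ v, δ (T v) = T (δ v)) → ∀ ε ∈ W, Derivation.adj δ ε ∈ W := by
    rintro δ hδ hδT ε ⟨hε, hεT⟩
    have hεT' : ∀ v, T (ε v) = ε (T v) := fun v => by
      rw [← sub_eq_zero, ← Derivation.adj_apply, hεT]; rfl
    refine ⟨by rw [Derivation.adj_apply, hδ, hε]; simp, ?_⟩
    refine Derivation.ext fun i => ?_
    simp only [Derivation.adj_apply, map_sub, hδT, ← hεT', Derivation.zero_apply]
    simp only [← hδT, hεT', sub_self]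
  have hWD := hW D h.D_t h.dT
  have hWU := hW U h.U_t h.uT
  have hWE := hW E h.E_t h.eT
  have hiter : ∀ A : Module.End k (Derivation k (MvPolynomial σ k) (MvPolynomial σ k)), (∀ ε ∈ W, A ε ∈ W) → ∀ (n : ℕ), ∀ ε ∈ W, A^[n] ε ∈ W := by
    intro A hA n ε hε
    induction n with
    | zero => exact hε
    | succ n ih => rw [Function.iterate_succ_apply']; exact hA _ ih
  have step₂ : ∃ Δ ∈ W, divergence Δ = 1 ∧ Derivation.adj E Δ = 0 := by
    obtain ⟨q, hq, hz⟩ := h.exists_weight_zero Δ₁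
    refine ⟨(q.eval 0)⁻¹ • Polynomial.aeval (Derivation.adj E) q Δ₁, W.smul_mem _ ?_, ?_, ?_⟩
    · rw [Polynomial.aeval_eq_sum_range, LinearMap.sum_apply]
      refine W.sum_mem fun i _ => W.smul_mem _ ?_
      rw [Module.End.pow_apply]
      exact hiter _ hWE i _ ⟨h₁t, h₁T⟩
    · rw [map_smul, LinearMap.aeval_intertwine (B := E.toLinearMap) (Derivation.divergence_adj divE), h₁,
        Polynomial.aeval_eq_sum_range, LinearMap.sum_apply, Finset.sum_range_succ',
        Finset.sum_eq_zero, zero_add]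
      · rw [pow_zero, Polynomial.coeff_zero_eq_eval_zero, LinearMap.smul_apply,
          Module.End.one_apply, smul_smul, inv_mul_cancel₀ hq, one_smul]
      · intro i _
        rw [LinearMap.smul_apply, pow_succ, Module.End.mul_apply]
        simp
    · rw [map_smul, hz, smul_zero]
  obtain ⟨Δ₂, h₂W, h₂, h₂E⟩ := step₂
  obtain ⟨N, hN⟩ := Derivation.locNil_adj h.locNil_D Δ₂
  obtain ⟨c, hc0, hcD, hcE⟩ := h.isSl2_adj.exists_invariant h₂E
    (iterate_eq_zero_of_le (map_zero _) (Nat.le_succ N) hN)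
  have hcU := h.isSl2_adj.U_eq_zero (Derivation.locNil_adj h.locNil_U) hcE hcD
  have hmem : ∀ i, (Derivation.adj U)^[i] ((Derivation.adj D)^[i] Δ₂) ∈ W := fun i =>
    hiter _ hWU i _ (hiter _ hWD i _ h₂W)
  set Δ := ∑ i ∈ Finset.range (N + 1), c i • (Derivation.adj U)^[i] ((Derivation.adj D)^[i] Δ₂) with hΔ
  have hΔW : Δ ∈ W := W.sum_mem fun i _ => W.smul_mem _ (hmem i)
  have hcomm : ∀ δ : Derivation k (MvPolynomial σ k) (MvPolynomial σ k), Derivation.adj δ Δ = 0 → ∀ v, Δ (δ v) = δ (Δ v) := fun δ hδ v => by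
    rw [eq_comm, ← sub_eq_zero, ← Derivation.adj_apply, hδ]; rfl
  refine ⟨Δ, hΔW.1, ?_, hcomm D hcD, hcomm U hcU, hcomm T hΔW.2⟩
  rw [hΔ, map_sum, Finset.sum_range_succ', Finset.sum_eq_zero, zero_add]
  · simp [hc0, h₂]
  · intro i _
    have hzero : ∀ n, divergence ((Derivation.adj D)^[n + 1] Δ₂) = 0 := by
      intro n
      induction n with
      | zero => simp [Derivation.divergence_adj divD, h₂]
      | succ n ih => rw [Function.iterate_succ_apply', Derivation.divergence_adj divD, ih, map_zero]
    have hU : ∀ (n : ℕ) (ε : Derivation k (MvPolynomial σ k) (MvPolynomial σ k)), divergence ε = 0 → divergence ((Derivation.adj U)^[n] ε) = 0 := by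
      intro n ε hε
      induction n with
      | zero => exact hε
      | succ n ih => rw [Function.iterate_succ_apply', Derivation.divergence_adj divU, ih, map_zero]
    rw [map_smul, hU _ _ (hzero i), smul_zero]

end Equivariant

end IsSl2Cylinder

namespace MvPolynomial

variable {k σ : Type*} [Field k] [Fintype σ]

theorem vecMul_derivations (δ : σ → Derivation k (MvPolynomial σ k) (MvPolynomial σ k))
    {c w : σ → MvPolynomial σ k} (h : Matrix.vecMul c (Matrix.of fun i j => δ i (X j)) = w) :
    ∑ i, c i • δ i = mkDerivation k w := by
  refine derivation_ext (R := k) fun j => ?_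
  rw [Derivation.finset_sum_apply, mkDerivation_X, ← h]
  rfl

variable [DecidableEq σ]

theorem det_derivations_update_eq_zero
    (δ : σ → Derivation k (MvPolynomial σ k) (MvPolynomial σ k)) {i l : σ} (hl : l ≠ i) (c : k) :
    (Matrix.of fun a j => Function.update δ i (c • δ l) a (X j)).det = 0 := by
  have : (Matrix.of fun a j => Function.update δ i (c • δ l) a (X j)) =
      (Matrix.of fun a j => δ a (X j)).updateRow i ((C c : MvPolynomial σ k) •
        (Matrix.of fun a j => δ a (X j)) l) := by
    refine Matrix.ext fun a j => ?_
    by_cases h : a = i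
    · subst h; simp [smul_eq_C_mul]
    · simp [h]
  rw [this, Matrix.det_updateRow_smul, Matrix.det_zero_of_row_eq hl, mul_zero]
  rw [Matrix.updateRow_self, Matrix.updateRow_ne hl]

theorem derivation_det_of_lie (δ : σ → Derivation k (MvPolynomial σ k) (MvPolynomial σ k))
    (Δ : Derivation k (MvPolynomial σ k) (MvPolynomial σ k))
    (h : ∀ i, ∃ l, l ≠ i ∧ ∃ c : k, ∀ v, Δ (δ i v) - δ i (Δ v) = c • δ l v) :
    Δ (Matrix.of fun i j => δ i (X j)).det =
      divergence Δ * (Matrix.of fun i j => δ i (X j)).det := by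
  rw [derivation_det_derivations, add_eq_left]
  refine Finset.sum_eq_zero fun i _ => ?_
  obtain ⟨l, hl, c, hc⟩ := h i
  rw [show ⁅Δ, δ i⁆ = c • δ l from Derivation.ext fun v => by
    rw [Derivation.commutator_apply, hc, Derivation.smul_apply]]
  exact det_derivations_update_eq_zero δ hl c

end MvPolynomial

namespace IsSl2Cylinder

open MvPolynomial

variable {k : Type*} [Field k] [CharZero k]
  {D U E T : Derivation k (MvPolynomial (Fin 4) k) (MvPolynomial (Fin 4) k)}
  {t : MvPolynomial (Fin 4) k}

theorem det_eq_zero (h : IsSl2Cylinder D U E T t) :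
    (Matrix.of fun i j => ![D, U, E, T] i (X j : MvPolynomial (Fin 4) k)).det = 0 := by
  obtain ⟨Δ, hΔt, hΔ, hΔD, hΔU, hΔT⟩ := h.exists_equivariant (by simp)
  have hΔE : ∀ v, Δ (E v) = E (Δ v) := fun v => by simp [h.E_eq, hΔD, hΔU]
  generalize hδ : ![D, U, E, T] = δ
  have d0 : δ 0 = D := by rw [← hδ]; rfl
  have d1 : δ 1 = U := by rw [← hδ]; rfl
  have d2 : δ 2 = E := by rw [← hδ]; rfl
  have d3 : δ 3 = T := by rw [← hδ]; rfl
  have cases4 : ∀ p : Fin 4 → Prop, p 0 → p 1 → p 2 → p 3 → ∀ i, p i := by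
    intro p h0 h1 h2 h3 i
    fin_cases i <;> assumption
  have hD := derivation_det_of_lie δ D (cases4 _ ⟨1, by decide, 0, by simp [d0]⟩
    ⟨2, by decide, 1, by simp [d1, d2, h.du]⟩
    ⟨0, by decide, -2, by simp [d0, d2, h.ed]⟩ ⟨0, by decide, 0, by simp [d3, h.dT]⟩)
  have hU := derivation_det_of_lie δ U (cases4 _ ⟨2, by decide, -1, by simp [d0, d2, h.du]⟩
    ⟨0, by decide, 0, by simp [d1]⟩
    ⟨1, by decide, 2, by simp [d1, d2, h.eu]⟩ ⟨0, by decide, 0, by simp [d3, h.uT]⟩)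
  have hs := derivation_det_of_lie δ Δ (cases4 _ ⟨2, by decide, 0, by simp [d0, hΔD]⟩
    ⟨0, by decide, 0, by simp [d1, hΔU]⟩
    ⟨1, by decide, 0, by simp [d2, hΔE]⟩ ⟨0, by decide, 0, by simp [d3, hΔT]⟩)
  rw [divergence_eq_zero h.locNil_D, zero_mul] at hD
  rw [divergence_eq_zero h.locNil_U, zero_mul] at hU
  rw [hΔ, one_mul] at hs
  set M := Matrix.of fun i j => δ i (X j : MvPolynomial (Fin 4) k) with hM
  have hE : E M.det = 0 := by rw [h.E_eq, hU, hD, map_zero, map_zero, sub_zero]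
  by_contra hne
  set w : Fin 4 → MvPolynomial (Fin 4) k := fun j => Δ (X j)
  have hc : Matrix.vecMul (Matrix.vecMul w M.adjugate) M = M.det • w := by
    rw [Matrix.vecMul_vecMul, Matrix.adjugate_mul, Matrix.vecMul_smul, Matrix.vecMul_one]
  have key := vecMul_derivations δ hc
  have key2 : M.det • Δ = ∑ i, Matrix.vecMul w M.adjugate i • δ i := by
    rw [key]
    refine derivation_ext (R := k) fun j => ?_
    rw [mkDerivation_X]; rfl
  have key3 : ∀ v, M.det * Δ v = ∑ i, Matrix.vecMul w M.adjugate i * δ i v := fun v => by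
    have := congrArg (fun e => e v) key2
    simpa [Derivation.finset_sum_apply] using this
  generalize Matrix.vecMul w M.adjugate = c at key3
  have ht := key3 t
  rw [hΔt, Fin.sum_univ_four, d0, d1, d2, d3, h.D_t, h.U_t, h.E_t, h.T_t] at ht
  have hc3 : c 3 = 0 := by simpa using ht.symm
  have h4 := key3 M.det
  rw [Fin.sum_univ_four, d0, d1, d2, hD, hU, hE, hc3, hs] at h4
  simp at h4
  exact hne h4

/-- The three derivations of the `sl₂`-action are linearly dependent over the ring. -/
theorem exists_relation (h : IsSl2Cylinder D U E T t) :
    ∃ α β γ : MvPolynomial (Fin 4) k, ¬(α = 0 ∧ β = 0 ∧ γ = 0) ∧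
      ∀ v, α * D v + β * U v + γ * E v = 0 := by
  obtain ⟨c, hc, h0⟩ := Matrix.exists_vecMul_eq_zero_iff.2 h.det_eq_zero
  have key := vecMul_derivations _ h0
  have key3 : ∀ v, c 0 * D v + c 1 * U v + c 2 * E v + c 3 * T v = 0 := fun v => by
    have := congrArg (fun e => e v) key
    rw [show mkDerivation k (0 : Fin 4 → MvPolynomial (Fin 4) k) = 0 from
      derivation_ext (R := k) fun j => by rw [mkDerivation_X]; rfl] at this
    simpa [Derivation.finset_sum_apply, Fin.sum_univ_four] using this
  have hc3 : c 3 = 0 := by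
    simpa [h.D_t, h.U_t, h.E_t, h.T_t] using key3 t
  refine ⟨c 0, c 1, c 2, fun ⟨h0, h1, h2⟩ => hc ?_, fun v => by simpa [hc3] using key3 v⟩
  funext i
  fin_cases i <;> assumption

end IsSl2Cylinder

namespace IsSl2Cylinder

variable {k R : Type*} [Field k] [CommRing R] [Algebra k R] {D U E T : Derivation k R R} {t : R}

theorem exists_polynomial_kills (h : IsSl2Cylinder D U E T t) (v : R) :
    ∃ s : Multiset ℤ, Polynomial.aeval (E : Module.End k R)
      (s.map fun d : ℤ => Polynomial.X - Polynomial.C (d : k)).prod v = 0 := by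
  refine h.weight_induction (p := fun v => ∃ s : Multiset ℤ, Polynomial.aeval
    (E : Module.End k R) (s.map fun d : ℤ => Polynomial.X - Polynomial.C (d : k)).prod v = 0)
    (fun d v hv => ⟨{d}, ?_⟩) (fun v w hv hw => ?_) v
  · simp [hv, Module.algebraMap_end_apply, Algebra.smul_def]
  · obtain ⟨s, hs⟩ := hv
    obtain ⟨s', hs'⟩ := hw
    refine ⟨s + s', ?_⟩
    rw [Multiset.map_add, Multiset.prod_add, map_add, map_mul]
    nth_rw 1 [← map_mul, mul_comm, map_mul]
    rw [Module.End.mul_apply, hs, Module.End.mul_apply, hs', map_zero, map_zero, add_zero]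

theorem U_iterate_E (h : IsSl2Cylinder D U E T t) (n : ℕ) (v : R) :
    U^[n] (E v) = E (U^[n] v) + (2 * n : k) • U^[n] v := by
  induction n with
  | zero => simp
  | succ n ih =>
    rw [Function.iterate_succ_apply', ih, Function.iterate_succ_apply', map_add,
      Derivation.map_smul, h.eu]
    push_cast
    module

theorem E_eq_zero (h : IsSl2Cylinder D U E T t) {v : R} (hD : D v = 0) (hU : U v = 0) :
    E v = 0 := by
  rw [h.E_eq, hD, hU, map_zero, map_zero, sub_zero]

variable [IsDomain R]

variable [CharZero k]

theorem dvd_E_of_dvd [UniqueFactorizationMonoid R] {p a : R} (hp : Prime p) (hpa : p ∣ a)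
    (ha : a ≠ 0) {m : k} (hm : E a = m • a) : p ∣ E p := by
  obtain ⟨j, b, hb, rfl⟩ := WfDvdMonoid.max_power_factor ha hp.irreducible
  obtain _ | j := j
  · exact absurd (by simpa using hpa) hb
  have hb0 : b ≠ 0 := right_ne_zero_of_mul ha
  rw [Derivation.leibniz, Derivation.leibniz_pow, Nat.add_sub_cancel, Algebra.smul_def m] at hm
  simp only [nsmul_eq_mul, smul_eq_mul] at hm
  have h2 : p ^ j * (b * ((j + 1 : ℕ) : R) * E p) =
      p ^ j * (p * (algebraMap k R m * b - E b)) := by linear_combination hm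
  have h3 : p ∣ b * ((j + 1 : ℕ) : R) * E p := by
    rw [mul_left_cancel₀ (pow_ne_zero j hp.ne_zero) h2]
    exact dvd_mul_right _ _
  have hu : IsUnit ((j + 1 : ℕ) : R) := by
    rw [← map_natCast (algebraMap k R)]
    exact (Nat.cast_ne_zero.2 j.succ_ne_zero).isUnit.map _
  exact ((hp.dvd_or_dvd h3).resolve_left fun h4 => (hp.dvd_or_dvd h4).elim hb
    fun h5 => hp.not_isUnit (isUnit_of_dvd_unit h5 hu))

variable [CharZero R]

theorem isUnit_invariant (h : IsSl2Cylinder D U E T t) {u : R} (hu : IsUnit u) :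
    D u = 0 ∧ U u = 0 ∧ T u = 0 :=
  ⟨Derivation.eq_zero_of_dvd h.locNil_D one_ne_zero (Derivation.map_one_eq_zero D) hu.dvd,
    Derivation.eq_zero_of_dvd h.locNil_U one_ne_zero (Derivation.map_one_eq_zero U) hu.dvd,
    Derivation.eq_zero_of_dvd h.locNil_T one_ne_zero (Derivation.map_one_eq_zero T) hu.dvd⟩

theorem exists_weight_of_dvd (h : IsSl2Cylinder D U E T t) {p : R} (hp : p ≠ 0) (hpE : p ∣ E p)
    (hD : D p = 0) (hT : T p = 0) : ∃ e : ℕ, E p = (e : k) • p := by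
  obtain ⟨c, hc⟩ := hpE
  rcases eq_or_ne c 0 with rfl | hc0
  · exact ⟨0, by simp [hc]⟩
  have hUc : U c = 0 := by
    refine Derivation.eq_zero_of_iterate_mul h.locNil_U hp hc0 fun n hn => ?_
    rw [mul_comm, ← hc, h.U_iterate_E, hn, map_zero, smul_zero, add_zero]
  have hDc : D c = 0 := by
    have h1 := h.ed p
    rw [hD, map_zero, smul_zero, add_zero, hc, Derivation.leibniz, hD, smul_zero, add_zero,
      smul_eq_mul] at h1
    exact (mul_eq_zero.1 h1.symm).resolve_left hp
  have hEc := h.E_eq_zero hDc hUc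
  obtain ⟨s, hs⟩ := h.exists_polynomial_kills p
  have key : ∀ q : Polynomial k, Polynomial.aeval (E : Module.End k R) q p =
      Polynomial.aeval c q * p := by
    intro q
    induction q using Polynomial.induction_on' with
    | add q r hq hr => simp [hq, hr, add_mul]
    | monomial n a =>
      have : ∀ n : ℕ, ((E : Module.End k R) ^ n) p = c ^ n * p := by
        intro n
        induction n with
        | zero => simp
        | succ n ih =>
          rw [pow_succ', Module.End.mul_apply, ih]
          simp [Derivation.leibniz_pow, hEc, hc]
          ring
      rw [Polynomial.aeval_monomial, Polynomial.aeval_monomial, Module.End.mul_apply, this,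
        Module.algebraMap_end_apply, Algebra.smul_def, mul_assoc]
  rw [key, mul_eq_zero, or_iff_left hp, map_multiset_prod, Multiset.prod_eq_zero_iff,
    Multiset.map_map, Multiset.mem_map] at hs
  obtain ⟨d, -, hd⟩ := hs
  have hcd : c = algebraMap k R d := by simpa [sub_eq_zero] using hd
  have hEp : E p = (d : k) • p := by rw [hc, hcd, Algebra.smul_def, mul_comm]
  obtain ⟨e, he, -⟩ := h.isSl2.exists_nat_weight h.locNil_U hp hEp hD
  exact ⟨e, he ▸ hEp⟩

/-- A nonzero highest weight vector of positive weight, invariant under `T`. -/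
theorem exists_pos_weight (h : IsSl2Cylinder D U E T t) (hD : ∃ v, D v ≠ 0) :
    ∃ a : R, a ≠ 0 ∧ D a = 0 ∧ T a = 0 ∧ ∃ d : ℕ, 0 < d ∧ E a = (d : k) • a := by
  obtain ⟨b, d, hb, hDb⟩ : ∃ b, ∃ d : ℤ, E b = (d : k) • b ∧ D b ≠ 0 := by
    by_contra! hcon
    obtain ⟨v, hv⟩ := hD
    exact hv (h.weight_induction (p := fun v => D v = 0) (fun d v hv => hcon v d hv)
      (fun v w hv hw => by rw [map_add, hv, hw, add_zero]) v)
  obtain ⟨n, hn, hn'⟩ := h.locNil_D.exists_top hDb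
  rw [← Function.iterate_succ_apply] at hn hn'
  have hE := h.isSl2.weight_iterate_D hb (n + 1)
  set a := D^[n + 1] b with ha
  have hDa : D a = 0 := by rw [ha, ← Function.iterate_succ_apply' D, hn']
  obtain ⟨e, he, -⟩ := h.isSl2.exists_nat_weight h.locNil_U hn hE hDa
  have hEa : E a = (e : k) • a := by rw [← he]; exact hE
  have he0 : 0 < e := by
    rcases Nat.eq_zero_or_pos e with rfl | he0
    · exfalso
      have hUa := h.isSl2.U_eq_zero h.locNil_U (v := a) (by simpa using hEa) hDa
      refine hn ?_
      rw [ha, Function.iterate_succ_apply'] at hUa ⊢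
      refine h.isSl2.D_eq_zero h.locNil_U ?_ hUa
      refine (h.isSl2.weight_iterate_D hb n).trans ?_
      congr 1
      push_cast at he
      linear_combination he
    · exact he0
  have hcomm : ∀ (δ : Derivation k R R) (_ : ∀ v, δ (T v) = T (δ v)) (n : ℕ) (v : R),
      δ (T^[n] v) = T^[n] (δ v) := fun δ hδ n v =>
    ((Function.Commute.iterate_right (show Function.Commute δ T from hδ) n) v)
  obtain ⟨m, hm, hm'⟩ := h.locNil_T.exists_top hn
  refine ⟨T^[m] a, hm, ?_, ?_, e, he0, ?_⟩
  · rw [hcomm D h.dT, hDa, Derivation.iterate_zero_arg]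
  · rw [← Function.iterate_succ_apply' T, hm']
  · rw [hcomm E h.eT, hEa]
    exact (Function.Commute.iterate_left (g := fun v => (e : k) • v)
      (show Function.Commute T _ from fun v => T.map_smul _ v) m) a

variable [UniqueFactorizationMonoid R]

theorem prime_of_dvd (h : IsSl2Cylinder D U E T t) {p a : R} (hp : Prime p) (hpa : p ∣ a)
    (ha : a ≠ 0) {m : k} (hD : D a = 0) (hT : T a = 0) (hE : E a = m • a) :
    D p = 0 ∧ T p = 0 ∧ ∃ e : ℕ, E p = (e : k) • p := by
  have hDp := Derivation.eq_zero_of_dvd h.locNil_D ha hD hpa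
  have hTp := Derivation.eq_zero_of_dvd h.locNil_T ha hT hpa
  exact ⟨hDp, hTp, h.exists_weight_of_dvd hp.ne_zero (dvd_E_of_dvd hp hpa ha hE) hDp hTp⟩

theorem weight_of_mul (h : IsSl2Cylinder D U E T t) {p a : R} (ha : p * a ≠ 0) {m e : k}
    (hD : D (p * a) = 0) (hT : T (p * a) = 0) (hE : E (p * a) = m • (p * a)) (hp : E p = e • p) :
    D a = 0 ∧ T a = 0 ∧ E a = (m - e) • a := by
  refine ⟨Derivation.eq_zero_of_dvd h.locNil_D ha hD (dvd_mul_left _ _),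
    Derivation.eq_zero_of_dvd h.locNil_T ha hT (dvd_mul_left _ _),
    mul_left_cancel₀ (left_ne_zero_of_mul ha) ?_⟩
  rw [Derivation.leibniz, hp] at hE
  simp only [smul_eq_mul, Algebra.smul_def] at hE ⊢
  rw [map_sub]
  linear_combination hE

theorem exists_prime_of_pos_weight (h : IsSl2Cylinder D U E T t) (a : R) : a ≠ 0 → D a = 0 →
    T a = 0 → ∀ m : k, m ≠ 0 → E a = m • a →
    ∃ x, Prime x ∧ D x = 0 ∧ T x = 0 ∧ ∃ d : ℕ, 0 < d ∧ E x = (d : k) • x := by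
  induction a using UniqueFactorizationMonoid.induction_on_prime with
  | h₁ => exact fun h0 => absurd rfl h0
  | h₂ u hu =>
    intro hu0 hD _ m hm hE
    rw [h.E_eq_zero hD (h.isUnit_invariant hu).2.1] at hE
    exact absurd hE.symm (smul_ne_zero hm hu0)
  | h₃ a p ha hp ih =>
    intro hpa hD hT m hm hE
    obtain ⟨hDp, hTp, e, he⟩ := h.prime_of_dvd hp (dvd_mul_right p a) hpa hD hT hE
    rcases Nat.eq_zero_or_pos e with rfl | he0
    · obtain ⟨hDa, hTa, hEa⟩ := h.weight_of_mul hpa hD hT hE he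
      exact ih ha hDa hTa m hm (by simpa using hEa)
    · exact ⟨p, hp, hDp, hTp, e, he0, he⟩

theorem associated_of_relation (h : IsSl2Cylinder D U E T t) {α β γ : R}
    (hne : ¬(α = 0 ∧ β = 0 ∧ γ = 0)) (hrel : ∀ v, α * D v + β * U v + γ * E v = 0)
    (hDne : ∃ v, D v ≠ 0) {x z : R} (hx : Prime x) (hz : Prime z) (hDx : D x = 0) (hDz : D z = 0)
    {d e : ℕ} (hd : 0 < d) (he : 0 < e) (hEx : E x = (d : k) • x) (hEz : E z = (e : k) • z) :
    Associated x z := by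
  have hd0 : (d : R) ≠ 0 := Nat.cast_ne_zero.2 hd.ne'
  have he0 : (e : R) ≠ 0 := Nat.cast_ne_zero.2 he.ne'
  have h1 := hrel x
  have h2 := hrel z
  simp only [hDx, hDz, hEx, hEz, mul_zero, zero_add, Algebra.smul_def, map_natCast] at h1 h2
  have hβ : β ≠ 0 := by
    rintro rfl
    have hγ : γ = 0 := by
      simpa [hd0, hx.ne_zero] using h1
    subst hγ
    obtain ⟨v, hv⟩ := hDne
    exact hne ⟨by simpa [hv] using hrel v, rfl, rfl⟩
  have h3 : (e : R) * z * U x = d * x * U z := mul_left_cancel₀ hβ (by linear_combination e * z * h1 - d * x * h2)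
  by_contra hass
  have hxz : ¬ x ∣ z := fun hxz => hass (hx.associated_of_dvd hz hxz)
  have hxe : ¬ x ∣ (e : R) := fun hxe => hx.not_isUnit (isUnit_of_dvd_unit hxe (by
    rw [← map_natCast (algebraMap k R)]
    exact (Nat.cast_ne_zero.2 he.ne').isUnit.map _))
  have h4 : x ∣ (e : R) * z * U x := ⟨d * U z, by rw [h3]; ring⟩
  have h5 : x ∣ U x := ((hx.dvd_or_dvd h4).resolve_left fun h6 =>
    (hx.dvd_or_dvd h6).elim hxe hxz)
  have hUx := Derivation.eq_zero_of_dvd_self h.locNil_U h5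
  have h6 := h.E_eq_zero hDx hUx
  rw [hEx] at h6
  exact smul_ne_zero (Nat.cast_ne_zero.2 hd.ne') hx.ne_zero h6

theorem exists_eq_mul_pow (h : IsSl2Cylinder D U E T t) {α β γ : R}
    (hne : ¬(α = 0 ∧ β = 0 ∧ γ = 0)) (hrel : ∀ v, α * D v + β * U v + γ * E v = 0)
    (hDne : ∃ v, D v ≠ 0) {x : R} (hx : Prime x) (hDx : D x = 0)
    {d : ℕ} (hd : 0 < d) (hEx : E x = (d : k) • x) (a : R) : D a = 0 → T a = 0 →
    ∀ m : k, E a = m • a →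
    ∃ u, ∃ n : ℕ, a = u * x ^ n ∧ D u = 0 ∧ T u = 0 ∧ E u = 0 := by
  induction a using UniqueFactorizationMonoid.induction_on_prime with
  | h₁ => exact fun _ _ _ _ => ⟨0, 0, by simp⟩
  | h₂ u hu =>
    intro hD hT m hE
    exact ⟨u, 0, by simp, hD, hT, h.E_eq_zero hD (h.isUnit_invariant hu).2.1⟩
  | h₃ a p ha hp ih =>
    intro hD hT m hE
    have hpa : p * a ≠ 0 := mul_ne_zero hp.ne_zero ha
    obtain ⟨hDp, hTp, e, he⟩ := h.prime_of_dvd hp (dvd_mul_right p a) hpa hD hT hE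
    obtain ⟨hDa, hTa, hEa⟩ := h.weight_of_mul hpa hD hT hE he
    obtain ⟨u, n, rfl, hDu, hTu, hEu⟩ := ih hDa hTa _ hEa
    rcases Nat.eq_zero_or_pos e with rfl | he0
    · refine ⟨p * u, n, by ring, ?_, ?_, ?_⟩
      · simp [hDp, hDu]
      · simp [hTp, hTu]
      · simp [he, hEu]
    · obtain ⟨w, rfl⟩ := h.associated_of_relation hne hrel hDne hx hp hDx hDp hd he0 hEx he
      obtain ⟨hDw, hUw, hTw⟩ := h.isUnit_invariant w.isUnit
      refine ⟨w * u, n + 1, by ring, ?_, ?_, ?_⟩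
      · simp [hDw, hDu]
      · simp [hTw, hTu]
      · simp [h.E_eq_zero hDw hUw, hEu]

end IsSl2Cylinder

namespace Derivation

variable {k R : Type*} [CommRing k] [CommRing R] [Algebra k R]

theorem aeval_apply_of_subalgebra (δ : Derivation k R R) {S : Subalgebra k R}
    (hS : ∀ s ∈ S, δ s = 0) (v : R) (p : Polynomial S) :
    δ (Polynomial.aeval v p) = Polynomial.aeval v (Polynomial.derivative p) * δ v := by
  induction p using Polynomial.induction_on' with
  | add p q hp hq => simp [hp, hq, add_mul]
  | monomial n a =>
    have ha : δ (algebraMap S R a) = 0 := hS _ a.2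
    rw [Polynomial.aeval_monomial, leibniz, ha, smul_zero, add_zero, leibniz_pow,
      Polynomial.derivative_monomial, Polynomial.aeval_monomial]
    have h2 : algebraMap S R (a * (n : S)) = algebraMap S R a * (n : R) := by
      rw [map_mul]; rfl
    rw [h2]
    simp only [smul_eq_mul, nsmul_eq_mul]
    ring

theorem transcendental_of_ne_zero [IsDomain R] [CharZero R] (δ : Derivation k R R)
    {S : Subalgebra k R} (hS : ∀ s ∈ S, δ s = 0) {v : R} (hv : δ v ≠ 0) : Transcendental S v := by
  have key : ∀ (n : ℕ) (p : Polynomial S), p.natDegree ≤ n → Polynomial.aeval v p = 0 →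
      p = 0 := by
    intro n
    induction n with
    | zero =>
      intro p hp h0
      rw [Polynomial.eq_C_of_natDegree_le_zero hp, Polynomial.aeval_C] at h0
      rw [Polynomial.eq_C_of_natDegree_le_zero hp, show p.coeff 0 = 0 from
        (FaithfulSMul.algebraMap_injective S R) (by rw [h0, map_zero]), map_zero]
    | succ n ih =>
      intro p hp h0
      have h1 := δ.aeval_apply_of_subalgebra hS v p
      rw [h0, map_zero] at h1
      have h2 := ih (Polynomial.derivative p) ((Polynomial.natDegree_derivative_le p).trans
        (by omega)) ((mul_eq_zero.1 h1.symm).resolve_right hv)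
      have h3 := Polynomial.natDegree_eq_zero_of_derivative_eq_zero h2
      rw [Polynomial.eq_C_of_natDegree_eq_zero h3, Polynomial.aeval_C] at h0
      rw [Polynomial.eq_C_of_natDegree_eq_zero h3, show p.coeff 0 = 0 from
        (FaithfulSMul.algebraMap_injective S R) (by rw [h0, map_zero]), map_zero]
  exact fun ⟨p, hp, h0⟩ => hp (key _ p le_rfl h0)

end Derivation

section Bivariate

open Polynomial

theorem exists_bivariate_of_isAlgebraic {k R : Type*} [Field k] [CommRing R] [Algebra k R]
    {g π : R} (hg : IsAlgebraic (Algebra.adjoin k {π}) g) :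
    ∃ P : k[X][X], P ≠ 0 ∧ eval₂ (aeval π : k[X] →ₐ[k] R).toRingHom g P = 0 := by
  obtain ⟨p, hp, h0⟩ := hg
  let φ : k[X] →+* Algebra.adjoin k {π} := (aeval (⟨π, Algebra.self_mem_adjoin_singleton k π⟩ :
    Algebra.adjoin k {π})).toRingHom
  have hφ : Function.Surjective φ := by
    rintro ⟨s, hs⟩
    have hs' := hs
    rw [Algebra.adjoin_singleton_eq_range_aeval] at hs'
    obtain ⟨q, rfl⟩ := hs'
    refine ⟨q, Subtype.ext ?_⟩
    change (Algebra.adjoin k {π}).val (aeval _ q) = aeval π q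
    rw [← aeval_algHom_apply]
    rfl
  obtain ⟨P, rfl⟩ := map_surjective φ hφ p
  refine ⟨P, fun h => hp (by rw [h, Polynomial.map_zero]), ?_⟩
  rw [aeval_def, eval₂_map] at h0
  rw [← h0]
  congr 1
  refine ringHom_ext (fun a => ?_) ?_
  · simp [φ]
  · simp [φ]

theorem dvd_of_bivariate_eq_zero {k R : Type*} [Field k] [IsAlgClosed k] [CommRing R] [IsDomain R]
    [Algebra k R] (φ : R →ₐ[k] k) {g π : R} (hπ : Prime π) (hφπ : φ π = 0) (hφg : φ g = 0)
    {P : k[X][X]} (hP : P ≠ 0) (h0 : eval₂ (aeval π : k[X] →ₐ[k] R).toRingHom g P = 0) :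
    π ∣ g := by
  have hX : Prime (C X : k[X][X]) := prime_C_iff.2 prime_X
  obtain ⟨m, P', hP', rfl⟩ := WfDvdMonoid.max_power_factor hP hX.irreducible
  rw [eval₂_mul, eval₂_pow, eval₂_C] at h0
  have h1 : eval₂ (aeval π : k[X] →ₐ[k] R).toRingHom g P' = 0 := by
    refine (mul_eq_zero.1 h0).resolve_left (pow_ne_zero _ ?_)
    simpa using hπ.ne_zero
  have hq : P'.map (evalRingHom (0 : k)) ≠ 0 := by
    intro hq
    refine hP' ((C_dvd_iff_dvd_coeff _ _).2 fun i => X_dvd_iff.2 ?_)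
    have := congrArg (fun q => q.coeff i) hq
    rw [coeff_zero_eq_eval_zero]
    simpa using this
  set q := P'.map (evalRingHom (0 : k))
  have h2 : π ∣ aeval g q := by
    rw [← Ideal.mem_span_singleton, ← Ideal.Quotient.eq_zero_iff_mem, aeval_def, hom_eval₂,
      eval₂_map]
    have h3 := congrArg (Ideal.Quotient.mk (Ideal.span {π})) h1
    rw [hom_eval₂, map_zero] at h3
    rw [← h3]
    congr 1
    refine ringHom_ext (fun a => ?_) ?_
    · simp
    · simpa using (Ideal.Quotient.eq_zero_iff_mem.2 (Ideal.mem_span_singleton_self π)).symm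
  have hs := (IsAlgClosed.splits q).eq_prod_roots
  rw [hs, map_mul, aeval_C] at h2
  have h3 := (hπ.dvd_or_dvd h2).resolve_left fun h4 => hπ.not_isUnit (isUnit_of_dvd_unit h4
    ((leadingCoeff_ne_zero.2 hq).isUnit.map _))
  rw [map_multiset_prod, Multiset.map_map] at h3
  obtain ⟨z, hz, hπz⟩ := hπ.exists_mem_multiset_dvd h3
  obtain ⟨c, -, rfl⟩ := Multiset.mem_map.1 hz
  simp only [Function.comp_apply, map_sub, aeval_X, aeval_C] at hπz
  have hc : c = 0 := by
    obtain ⟨b, hb⟩ := hπz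
    simpa [hφg, hφπ] using congrArg φ hb
  simpa [hc] using hπz

theorem eq_algebraMap_of_isAlgebraic {k R : Type*} [Field k] [IsAlgClosed k] [CommRing R]
    [IsDomain R] [Algebra k R] {g : R} (hg : IsAlgebraic k g) : ∃ c, g = algebraMap k R c := by
  obtain ⟨q, hq, h0⟩ := hg
  rw [(IsAlgClosed.splits q).eq_prod_roots, map_mul, aeval_C, mul_eq_zero,
    or_iff_right ((leadingCoeff_ne_zero.2 hq).isUnit.map _).ne_zero, map_multiset_prod,
    Multiset.map_map, Multiset.prod_eq_zero_iff, Multiset.mem_map] at h0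
  obtain ⟨c, -, hc⟩ := h0
  exact ⟨c, by simpa [sub_eq_zero] using hc⟩

end Bivariate

namespace IsSl2Cylinder

open MvPolynomial

variable {k : Type*} [Field k] [CharZero k]
  {D U E T : Derivation k (MvPolynomial (Fin 4) k) (MvPolynomial (Fin 4) k)}
  {t : MvPolynomial (Fin 4) k}

theorem isAlgebraic_adjoin (h : IsSl2Cylinder D U E T t) {x : MvPolynomial (Fin 4) k} (hx : x ≠ 0)
    (hDx : D x = 0) (hTx : T x = 0) {d : ℕ} (hd : 0 < d) (hEx : E x = (d : k) • x)
    {g π : MvPolynomial (Fin 4) k} (hDg : D g = 0) (hUg : U g = 0) (hTg : T g = 0)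
    (hDπ : D π = 0) (hUπ : U π = 0) (hTπ : T π = 0) (hπ : Transcendental k π) :
    IsAlgebraic (Algebra.adjoin k {π}) g := by
  have hEx0 : E x ≠ 0 := by rw [hEx]; exact smul_ne_zero (Nat.cast_ne_zero.2 hd.ne') hx
  by_contra hg
  have killed : ∀ (δ : Derivation k (MvPolynomial (Fin 4) k) (MvPolynomial (Fin 4) k))
      (s : Set (MvPolynomial (Fin 4) k)), (∀ a ∈ s, δ a = 0) → ∀ a ∈ Algebra.adjoin k s, δ a = 0 :=
    fun δ s hs a ha => by
      have := Derivation.eqOn_adjoin (D1 := δ) (D2 := 0) (s := s) fun a ha => hs a ha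
      exact this ha
  have a1 : AlgebraicIndependent k (fun _ : Unit => π) :=
    algebraicIndependent_unique_type_iff.2 hπ
  have a2 := (a1.option_iff_transcendental g).2 (by rw [Set.range_const]; exact hg)
  have a3 := (a2.option_iff_transcendental x).2 (E.transcendental_of_ne_zero (killed E _ (by
    rintro _ ⟨o, rfl⟩
    rcases o with _ | _
    · exact h.E_eq_zero hDg hUg
    · exact h.E_eq_zero hDπ hUπ)) hEx0)
  have a4 := (a3.option_iff_transcendental (U x)).2 (D.transcendental_of_ne_zero (killed D _ (by
    rintro _ ⟨o, rfl⟩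
    rcases o with _ | _ | _
    · exact hDx
    · exact hDg
    · exact hDπ)) (by rw [h.du, hDx, map_zero, zero_add]; exact hEx0))
  have a5 := (a4.option_iff_transcendental t).2 (T.transcendental_of_ne_zero (killed T _ (by
    rintro _ ⟨o, rfl⟩
    rcases o with _ | _ | _ | _
    · change T (U x) = 0
      rw [← h.uT, hTx, map_zero]
    · exact hTx
    · exact hTg
    · exact hTπ)) (by rw [h.T_t]; exact one_ne_zero))
  have := a5.lift_cardinalMk_le_trdeg
  rw [MvPolynomial.trdeg_of_isDomain] at this
  simp at this
  norm_num at this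

/-- The ring of invariants is generated by one element. -/
theorem exists_generator_invariants [IsAlgClosed k] (h : IsSl2Cylinder D U E T t)
    {x : MvPolynomial (Fin 4) k} (hx : x ≠ 0)
    (hDx : D x = 0) (hTx : T x = 0) {d : ℕ} (hd : 0 < d) (hEx : E x = (d : k) • x) :
    ∃ f, D f = 0 ∧ U f = 0 ∧ T f = 0 ∧
      ∀ g, D g = 0 → U g = 0 → T g = 0 → g ∈ Algebra.adjoin k {f} := by
  let φ : MvPolynomial (Fin 4) k →ₐ[k] k := aeval fun _ => 0
  by_cases hc : ∀ g, D g = 0 → U g = 0 → T g = 0 → φ g = 0 → g = 0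
  · refine ⟨0, map_zero D, map_zero U, map_zero T, fun g hD hU hT => ?_⟩
    have := hc (g - C (φ g)) (by simp [hD]) (by simp [hU]) (by simp [hT])
      (by simp [φ])
    rw [sub_eq_zero.1 this]
    exact Subalgebra.algebraMap_mem _ _
  push Not at hc
  obtain ⟨g0, hD0, hU0, hT0, hφ0, hg0⟩ := hc
  obtain ⟨π, hπ, hπg, hφπ⟩ : ∃ π, Prime π ∧ π ∣ g0 ∧ φ π = 0 := by
    have hfac := UniqueFactorizationMonoid.factors_prod hg0
    have hp : φ (UniqueFactorizationMonoid.factors g0).prod = 0 := by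
      obtain ⟨u, hu⟩ := hfac.symm
      rw [← hu, map_mul, hφ0, zero_mul]
    rw [map_multiset_prod, Multiset.prod_eq_zero_iff, Multiset.mem_map] at hp
    obtain ⟨π, hπ, hφπ⟩ := hp
    exact ⟨π, UniqueFactorizationMonoid.prime_of_factor π hπ,
      UniqueFactorizationMonoid.dvd_of_mem_factors hπ, hφπ⟩
  have hDπ := Derivation.eq_zero_of_dvd h.locNil_D hg0 hD0 hπg
  have hUπ := Derivation.eq_zero_of_dvd h.locNil_U hg0 hU0 hπg
  have hTπ := Derivation.eq_zero_of_dvd h.locNil_T hg0 hT0 hπg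
  have htr : Transcendental k π := by
    intro halg
    obtain ⟨c, rfl⟩ := eq_algebraMap_of_isAlgebraic halg
    rw [φ.commutes] at hφπ
    exact hπ.ne_zero (by rw [show c = 0 from hφπ, map_zero])
  have hdeg : 0 < π.totalDegree := by
    by_contra h0
    rw [totalDegree_eq_zero_iff_eq_C.1 (by omega : π.totalDegree = 0)] at hφπ
    refine hπ.ne_zero ?_
    rw [totalDegree_eq_zero_iff_eq_C.1 (by omega : π.totalDegree = 0)]
    rw [show coeff 0 π = 0 by simpa [φ] using hφπ, map_zero]
  refine ⟨π, hDπ, hUπ, hTπ, ?_⟩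
  have key : ∀ n g, g.totalDegree ≤ n → D g = 0 → U g = 0 → T g = 0 →
      g ∈ Algebra.adjoin k {π} := by
    intro n
    induction n with
    | zero =>
      intro g hg _ _ _
      rw [totalDegree_eq_zero_iff_eq_C.1 (by omega : g.totalDegree = 0)]
      exact Subalgebra.algebraMap_mem _ _
    | succ n ih =>
      intro g hg hD hU hT
      have hD' : D (g - C (φ g)) = 0 := by simp [hD]
      have hU' : U (g - C (φ g)) = 0 := by simp [hU]
      have hT' : T (g - C (φ g)) = 0 := by simp [hT]
      obtain ⟨P, hP, hP0⟩ := exists_bivariate_of_isAlgebraic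
        (h.isAlgebraic_adjoin hx hDx hTx hd hEx hD' hU' hT' hDπ hUπ hTπ htr)
      obtain ⟨q, hq⟩ := dvd_of_bivariate_eq_zero φ hπ hφπ (by simp [φ]) hP hP0
      have hgq : g = C (φ g) + π * q := by rw [← hq]; ring
      rw [hgq]
      refine add_mem (Subalgebra.algebraMap_mem _ _)
        (mul_mem (Algebra.self_mem_adjoin_singleton k π) ?_)
      by_cases hq0 : q = 0
      · rw [hq0]; exact zero_mem _
      have hne : π * q ≠ 0 := mul_ne_zero hπ.ne_zero hq0
      rw [hq] at hD' hU' hT'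
      refine ih q ?_ (Derivation.eq_zero_of_dvd h.locNil_D hne hD' (dvd_mul_left _ _))
        (Derivation.eq_zero_of_dvd h.locNil_U hne hU' (dvd_mul_left _ _))
        (Derivation.eq_zero_of_dvd h.locNil_T hne hT' (dvd_mul_left _ _))
      have h1 := totalDegree_mul_of_isDomain hπ.ne_zero hq0
      have h2 := totalDegree_sub g (C (φ g))
      rw [hq, h1, totalDegree_C] at h2
      omega
  exact fun g => key _ g le_rfl

end IsSl2Cylinder

namespace Derivation

theorem iterate_pow_self {k R : Type*} [CommRing k] [CommRing R] [Algebra k R]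
    (δ : Derivation k R R) {t : R} (ht : δ t = 1) (n : ℕ) : δ^[n] (t ^ n) = (n.factorial : R) := by
  induction n with
  | zero => simp
  | succ n ih =>
    rw [Function.iterate_succ_apply, leibniz_pow, ht, Nat.add_sub_cancel, smul_eq_mul, mul_one,
      nsmul_eq_mul, δ.iterate_mul_of_eq_zero (map_natCast δ _), ih, Nat.factorial_succ,
      Nat.cast_mul]

end Derivation

namespace IsSl2Cylinder

variable {k R : Type*} [Field k] [CharZero k] [CommRing R] [Algebra k R]
  {D U E T : Derivation k R R} {t : R}

theorem mem_of_highest (h : IsSl2Cylinder D U E T t) {S : Subalgebra k R} (ht : t ∈ S)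
    (hS : ∀ (a : R) (m : k), D a = 0 → T a = 0 → E a = m • a → a ∈ S) {a : R} {m : k}
    (hD : D a = 0) (hE : E a = m • a) : a ∈ S := by
  have key : ∀ (n : ℕ) (a : R), T^[n] a = 0 → D a = 0 → E a = m • a → a ∈ S := by
    intro n
    induction n with
    | zero => intro a ha _ _; rw [show a = 0 from ha]; exact zero_mem S
    | succ n ih =>
      intro a ha hD hE
      have comm : ∀ (δ : Derivation k R R) (_ : ∀ v, δ (T v) = T (δ v)) (n : ℕ) (v : R),
          δ (T^[n] v) = T^[n] (δ v) := fun δ hδ n v =>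
        ((Function.Commute.iterate_right (show Function.Commute δ T from hδ) n) v)
      have hTsmul : ∀ (c : k) (v : R), T^[n] (c • v) = c • T^[n] v := fun c v =>
        (Function.Commute.iterate_left (g := fun v => c • v)
          (show Function.Commute T _ from fun v => T.map_smul _ v) n) v
      have hDc : D (T^[n] a) = 0 := by rw [comm D h.dT, hD, Derivation.iterate_zero_arg]
      have hTc : T (T^[n] a) = 0 := by rw [← Function.iterate_succ_apply' T, ha]
      have hEc : E (T^[n] a) = m • T^[n] a := by rw [comm E h.eT, hE, hTsmul]
      have hc := hS _ m hDc hTc hEc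
      have hn : (n.factorial : k) ≠ 0 := Nat.cast_ne_zero.2 n.factorial_ne_zero
      have hmem := ih (a - (n.factorial : k)⁻¹ • (T^[n] a * t ^ n)) ?_ ?_ ?_
      · simpa using add_mem hmem (S.smul_mem (mul_mem hc (pow_mem ht n)) (n.factorial : k)⁻¹)
      · rw [iterate_map_sub, hTsmul, T.iterate_mul_of_eq_zero hTc, T.iterate_pow_self h.T_t,
          mul_comm, ← nsmul_eq_mul, ← Nat.cast_smul_eq_nsmul k, inv_smul_smul₀ hn, sub_self]
      · simp [hD, hDc, h.D_t, Derivation.leibniz_pow]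
      · simp only [map_sub, hE, Derivation.map_smul, Derivation.leibniz, hEc, Derivation.leibniz_pow,
          h.E_t, smul_zero, zero_add, smul_eq_mul, smul_sub, mul_smul_comm, mul_comm (t ^ n)]
        rw [smul_comm m]
        simp
  obtain ⟨n, hn⟩ := h.locNil_T a
  exact key n a hn hD hE

theorem mem_of_nonneg (h : IsSl2Cylinder D U E T t) {S : Subalgebra k R} (hU : ∀ s ∈ S, U s ∈ S)
    (hS : ∀ (a : R) (m : k), D a = 0 → E a = m • a → a ∈ S) {v : R} {e : ℕ}
    (hv : E v = (e : k) • v) : v ∈ S := by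
  have key : ∀ (n : ℕ) (v : R), D^[n] v = 0 → E v = (e : k) • v → v ∈ S := by
    intro n
    induction n with
    | zero => intro a ha _; rw [show a = 0 from ha]; exact zero_mem S
    | succ n ih =>
      intro v hn hv
      have hDa : D (D^[n] v) = 0 := by rw [← Function.iterate_succ_apply' D, hn]
      have hEa : E (D^[n] v) = ((e : k) + 2 * n) • D^[n] v := h.isSl2.weight_iterate_D hv n
      have ha := hS _ _ hDa hEa
      have hUa : U^[n] (D^[n] v) ∈ S := by
        have : ∀ j : ℕ, U^[j] (D^[n] v) ∈ S := fun j => by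
          induction j with
          | zero => exact ha
          | succ j ih => rw [Function.iterate_succ_apply']; exact hU _ ih
        exact this n
      have hc := h.isSl2.D_iterate_U_iterate hEa hDa n
      set c := ∏ j ∈ Finset.range n, ((j + 1 : k) * ((e : k) + 2 * n - j)) with hcdef
      have hc0 : c ≠ 0 := by
        refine Finset.prod_ne_zero_iff.2 fun j hj => mul_ne_zero ?_ ?_
        · exact_mod_cast j.succ_ne_zero
        · rw [Finset.mem_range] at hj
          have : ((e : k) + 2 * n - j) = ((e + 2 * n - j : ℕ) : k) := by
            rw [Nat.cast_sub (by omega)]; push_cast; rfl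
          rw [this]
          exact Nat.cast_ne_zero.2 (by omega)
      have hDsmul : ∀ (c : k) (v : R), D^[n] (c • v) = c • D^[n] v := fun c v =>
        (Function.Commute.iterate_left (g := fun v => c • v)
          (show Function.Commute D _ from fun v => D.map_smul _ v) n) v
      have hmem := ih (v - c⁻¹ • U^[n] (D^[n] v)) ?_ ?_
      · simpa using add_mem hmem (S.smul_mem hUa c⁻¹)
      · rw [iterate_map_sub, hDsmul]
        have hc' : D^[n] (U^[n] (D^[n] v)) = c • D^[n] v := hc
        rw [hc', inv_smul_smul₀ hc0, sub_self]
      · have hEU : E (U^[n] (D^[n] v)) = ((e : k) + 2 * n - 2 * n) • U^[n] (D^[n] v) :=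
          h.isSl2.weight_iterate_U hEa n
        rw [map_sub, hv, Derivation.map_smul, hEU, add_sub_cancel_right, smul_sub, smul_comm]
  obtain ⟨n, hn⟩ := h.locNil_D v
  exact key n v hn hv

/-- A subalgebra stable under the `sl₂`-action which contains `t` and all `T`-invariant highest
weight vectors is the whole ring. -/
theorem eq_top_of_highest_mem (h : IsSl2Cylinder D U E T t) {S : Subalgebra k R} (ht : t ∈ S)
    (hDS : ∀ s ∈ S, D s ∈ S) (hUS : ∀ s ∈ S, U s ∈ S)
    (hS : ∀ (a : R) (m : k), D a = 0 → T a = 0 → E a = m • a → a ∈ S) : S = ⊤ := by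
  have hker : ∀ (a : R) (m : k), D a = 0 → E a = m • a → a ∈ S := fun a m hD hE =>
    h.mem_of_highest ht hS hD hE
  have hlow : ∀ (a : R) (m : k), U a = 0 → (-E) a = m • a → a ∈ S := by
    intro a m hU hE
    rcases eq_or_ne a 0 with rfl | ha
    · exact zero_mem S
    obtain ⟨n, rfl, hn⟩ := h.symm.isSl2.exists_nat_weight h.locNil_D ha hE hU
    have hEa : E a = (-n : k) • a := by rw [neg_smul, ← hE, Derivation.neg_apply, neg_neg]
    have hDa : D^[n] a ∈ S := hker _ _ (by rw [← Function.iterate_succ_apply' D]; exact hn)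
      (h.isSl2.weight_iterate_D hEa n)
    have hUa : ∀ j : ℕ, U^[j] (D^[n] a) ∈ S := fun j => by
      induction j with
      | zero => exact hDa
      | succ j ih => rw [Function.iterate_succ_apply']; exact hUS _ ih
    have hc : U^[n] (D^[n] a) = _ := h.symm.isSl2.D_iterate_U_iterate hE hU n
    have hc0 : ∏ j ∈ Finset.range n, ((j + 1 : k) * ((n : k) - j)) ≠ 0 := by
      refine Finset.prod_ne_zero_iff.2 fun j hj => mul_ne_zero ?_ ?_
      · exact_mod_cast j.succ_ne_zero
      · rw [Finset.mem_range] at hj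
        rw [← Nat.cast_sub hj.le]
        exact Nat.cast_ne_zero.2 (by omega)
    have := S.smul_mem (hUa n) (∏ j ∈ Finset.range n, ((j + 1 : k) * ((n : k) - j)))⁻¹
    rwa [hc, inv_smul_smul₀ hc0] at this
  refine eq_top_iff.2 fun v _ => h.weight_induction (p := fun v => v ∈ S) (fun d v hv => ?_)
    (fun v w => add_mem) v
  rcases le_total 0 d with hd | hd
  · lift d to ℕ using hd
    exact h.mem_of_nonneg hUS hker (e := d) (by simpa using hv)
  · obtain ⟨e, rfl⟩ := Int.exists_eq_neg_ofNat hd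
    exact h.symm.mem_of_nonneg hDS hlow (e := e) (by simp [hv])

end IsSl2Cylinder

theorem Derivation.mem_adjoin_of_forall {k R : Type*} [CommRing k] [CommRing R] [Algebra k R]
    (δ : Derivation k R R) {s : Set R} (hs : ∀ a ∈ s, δ a ∈ Algebra.adjoin k s) :
    ∀ a ∈ Algebra.adjoin k s, δ a ∈ Algebra.adjoin k s := by
  intro a ha
  induction ha using Algebra.adjoin_induction with
  | mem a ha => exact hs a ha
  | algebraMap c => rw [map_algebraMap]; exact zero_mem _
  | add a b _ _ ha hb => rw [map_add]; exact add_mem ha hb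
  | mul a b ha' hb' ha hb =>
    rw [leibniz]
    exact add_mem (mul_mem ha' hb) (mul_mem hb' ha)

namespace IsSl2Cylinder

section Highest

variable {k R : Type*} [Field k] [CharZero k] [CommRing R] [IsDomain R] [Algebra k R]
  {D U E T : Derivation k R R} {t : R}

theorem D_U_highest (h : IsSl2Cylinder D U E T t) {x : R} {d : ℕ} (hDx : D x = 0)
    (hEx : E x = (d : k) • x) : D (U x) = (d : k) • x := by
  rw [h.du, hDx, map_zero, zero_add, hEx]

theorem E_U_highest (h : IsSl2Cylinder D U E T t) {x : R} {d : ℕ}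
    (hEx : E x = (d : k) • x) : E (U x) = ((d : k) - 2) • U x := by
  rw [h.eu, hEx, Derivation.map_smul, sub_smul]

theorem D_U_U_highest (h : IsSl2Cylinder D U E T t) {x : R} {d : ℕ} (hDx : D x = 0)
    (hEx : E x = (d : k) • x) : D (U (U x)) = (2 * (d : k) - 2) • U x := by
  rw [h.du, h.D_U_highest hDx hEx, h.E_U_highest hEx, Derivation.map_smul]
  module

theorem E_U_U_highest (h : IsSl2Cylinder D U E T t) {x : R} {d : ℕ}
    (hEx : E x = (d : k) • x) : E (U (U x)) = ((d : k) - 4) • U (U x) := by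
  rw [h.eu, h.E_U_highest hEx, Derivation.map_smul]
  module

theorem not_dvd_sub (h : IsSl2Cylinder D U E T t) {x : R} (hx : x ≠ 0) {d : ℕ} (hd : 0 < d)
    (hDx : D x = 0) (hEx : E x = (d : k) • x) {c : k} (hc : ((d : k) - 2) * c = 0) :
    ¬ x ∣ U x - algebraMap k R c := by
  rintro ⟨b, hb⟩
  have hUx : U x = algebraMap k R c + x * b := by rw [← hb]; ring
  have hd0 : (d : k) ≠ 0 := Nat.cast_ne_zero.2 hd.ne'
  have h1 := h.D_U_highest hDx hEx
  have h2 := h.E_U_highest hEx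
  rw [hUx, map_add, Derivation.map_algebraMap, zero_add, Derivation.leibniz] at h1 h2
  rw [hDx, smul_zero, add_zero, smul_eq_mul, Algebra.smul_def, mul_comm _ x] at h1
  have hDb : D b = algebraMap k R d := mul_left_cancel₀ hx h1
  have hEb : E b = (-2 : k) • b := by
    refine mul_left_cancel₀ hx ?_
    have hc' : ((d : k) - 2) • algebraMap k R c = 0 := by
      rw [Algebra.smul_def, ← map_mul, hc, map_zero]
    rw [smul_add, hc', zero_add, hEx] at h2
    simp only [smul_eq_mul, Algebra.smul_def, map_sub, map_natCast] at h2 ⊢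
    rw [map_neg]
    linear_combination h2
  have := h.isSl2.D_eq_zero h.locNil_U hEb (by
    change U (D b) = 0
    rw [hDb, Derivation.map_algebraMap])
  have h3 : algebraMap k R d = 0 := by rw [← hDb]; exact this
  exact hd0 ((FaithfulSMul.algebraMap_injective k R) (by rw [h3, map_zero]))

/-- The quadratic invariant of weight `2 * d - 4`. -/
theorem D_quadric (h : IsSl2Cylinder D U E T t) {x : R} {d : ℕ} (hDx : D x = 0)
    (hEx : E x = (d : k) • x) :
    D (((d : k) - 1) • U x ^ 2 - (d : k) • (x * U (U x))) = 0 := by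
  simp only [map_sub, Derivation.map_smul, Derivation.leibniz_pow, Derivation.leibniz, hDx,
    h.D_U_highest hDx hEx, h.D_U_U_highest hDx hEx, smul_eq_mul, nsmul_eq_mul, Algebra.smul_def,
    map_natCast, map_one, map_mul, map_ofNat, Derivation.map_natCast,
    Derivation.map_one_eq_zero]
  ring

theorem E_quadric (h : IsSl2Cylinder D U E T t) {x : R} {d : ℕ}
    (hEx : E x = (d : k) • x) :
    E (((d : k) - 1) • U x ^ 2 - (d : k) • (x * U (U x))) =
      (2 * (d : k) - 4) • (((d : k) - 1) • U x ^ 2 - (d : k) • (x * U (U x))) := by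
  simp only [map_sub, Derivation.map_smul, Derivation.leibniz_pow, Derivation.leibniz, hEx,
    h.E_U_highest hEx, h.E_U_U_highest hEx, smul_eq_mul, nsmul_eq_mul, Algebra.smul_def,
    map_natCast, map_one, map_mul, map_ofNat, Derivation.map_natCast,
    Derivation.map_one_eq_zero]
  ring

end Highest

end IsSl2Cylinder

/-- The remaining case: all highest weights are even, generated by one vector `x` of weight two
and one invariant `f`. -/
structure IsSl2Quadric {k R : Type*} [Field k] [CommRing R] [Algebra k R]
    (D U E T : Derivation k R R) (t x f : R) (P : Polynomial k) : Prop
    extends IsSl2Cylinder D U E T t where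
  prime_x : Prime x
  D_x : D x = 0
  T_x : T x = 0
  E_x : E x = (2 : k) • x
  D_f : D f = 0
  U_f : U f = 0
  T_f : T f = 0
  invariant : ∀ g, D g = 0 → U g = 0 → T g = 0 → ∃ q : Polynomial k, g = Polynomial.aeval f q
  weight_two : ∀ g, D g = 0 → T g = 0 → E g = (2 : k) • g →
    ∃ q : Polynomial k, g = Polynomial.aeval f q * x
  highest : ∀ (g) (m : k), D g = 0 → E g = m • g → g ∈ Algebra.adjoin k {f, x, t}
  top : Algebra.adjoin k {f, x, U x, U (U x), t} = ⊤
  quadric : U x ^ 2 - 2 * x * U (U x) = Polynomial.aeval f P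
  transcendental_f : Transcendental k f
  natDegree_pos : 0 < P.natDegree

namespace IsSl2Cylinder

open MvPolynomial

variable {k : Type*} [Field k] [CharZero k] [IsAlgClosed k]
  {D U E T : Derivation k (MvPolynomial (Fin 4) k) (MvPolynomial (Fin 4) k)}
  {t : MvPolynomial (Fin 4) k}

theorem generated_or_quadric (h : IsSl2Cylinder D U E T t) (hD : ∃ v, D v ≠ 0) :
    (∃ a b c, T a = 0 ∧ T b = 0 ∧ T c = 0 ∧ Algebra.adjoin k {a, b, c, t} = ⊤) ∨
      ∃ x f P, IsSl2Quadric D U E T t x f P := by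
  obtain ⟨α, β, γ, hne, hrel⟩ := h.exists_relation
  obtain ⟨a, ha, hDa, hTa, m, hm, hEa⟩ := h.exists_pos_weight hD
  obtain ⟨x, hx, hDx, hTx, d, hd, hEx⟩ := h.exists_prime_of_pos_weight a ha hDa hTa m
    (Nat.cast_ne_zero.2 hm.ne') hEa
  obtain ⟨f, hDf, hUf, hTf, hf⟩ := h.exists_generator_invariants hx.ne_zero hDx hTx hd hEx
  have hfac : ∀ a, D a = 0 → T a = 0 → ∀ m : k, E a = m • a → ∃ u ∈ Algebra.adjoin k {f},
      ∃ n : ℕ, a = u * x ^ n ∧ E u = 0 := by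
    intro a hDa hTa m hEa
    obtain ⟨u, n, rfl, hDu, hTu, hEu⟩ := h.exists_eq_mul_pow hne hrel hD hx hDx hd hEx a hDa hTa m hEa
    exact ⟨u, hf u hDu (h.isSl2.U_eq_zero h.locNil_U hEu hDu) hTu, n, rfl, hEu⟩
  have hTUx : T (U x) = 0 := by rw [← h.uT, hTx, map_zero]
  have hTUUx : T (U (U x)) = 0 := by rw [← h.uT, hTUx, map_zero]
  have hQD := h.D_quadric hDx hEx
  have hQE := h.E_quadric hEx
  have hQT : T (((d : k) - 1) • U x ^ 2 - (d : k) • (x * U (U x))) = 0 := by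
    simp [hTx, hTUx, hTUUx, Derivation.leibniz_pow]
  have hmem : ∀ s : Set (MvPolynomial (Fin 4) k), f ∈ s → x ∈ s → ∀ (a) (m : k), D a = 0 →
      T a = 0 → E a = m • a → a ∈ Algebra.adjoin k s := by
    intro s hfs hxs a m hDa hTa hEa
    obtain ⟨u, hu, n, rfl, -⟩ := hfac a hDa hTa m hEa
    exact mul_mem (Algebra.adjoin_mono (by simpa using hfs) hu)
      (pow_mem (Algebra.subset_adjoin hxs) n)
  obtain ⟨d', hd', hUd⟩ := h.isSl2.exists_nat_weight h.locNil_U hx.ne_zero hEx hDx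
  obtain rfl : d = d' := by exact_mod_cast hd'
  have hUd : U^[d + 1] x = 0 := hUd
  rcases (by omega : d = 1 ∨ d = 2 ∨ 2 < d) with rfl | rfl | hd2
  · -- weight one
    left
    refine ⟨f, x, U x, hTf, hTx, hTUx, ?_⟩
    have hUUx : U (U x) = 0 := hUd
    refine h.eq_top_of_highest_mem (Algebra.subset_adjoin (by simp))
      (D.mem_adjoin_of_forall ?_) (U.mem_adjoin_of_forall ?_) (hmem _ (by simp) (by simp))
    · rintro a (rfl | rfl | rfl | rfl)
      · rw [hDf]; exact zero_mem _
      · rw [hDx]; exact zero_mem _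
      · rw [h.D_U_highest hDx hEx]
        exact Subalgebra.smul_mem _ (Algebra.subset_adjoin (by simp)) _
      · rw [h.D_t]; exact zero_mem _
    · rintro a (rfl | rfl | rfl | rfl)
      · rw [hUf]; exact zero_mem _
      · exact Algebra.subset_adjoin (by simp)
      · rw [hUUx]; exact zero_mem _
      · rw [h.U_t]; exact zero_mem _
  · -- weight two
    right
    have hUUUx : U (U (U x)) = 0 := hUd
    have hUQ := h.isSl2.U_eq_zero h.locNil_U (hQE.trans (by norm_num)) hQD
    obtain ⟨P, hP⟩ : ∃ P : Polynomial k, U x ^ 2 - 2 * x * U (U x) = Polynomial.aeval f P := by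
      have := hf _ hQD hUQ hQT
      rw [Algebra.adjoin_singleton_eq_range_aeval] at this
      obtain ⟨P, hP⟩ := this
      refine ⟨P, (Eq.trans ?_ hP.symm)⟩
      simp only [Algebra.smul_def, map_sub, map_natCast, map_one]
      push_cast
      ring
    have hEx2 : E x = (2 : k) • x := by simpa using hEx
    have hconst : ∀ c, Polynomial.aeval f P ≠ C c := by
      intro c hc
      obtain ⟨c0, rfl⟩ := IsAlgClosed.exists_pow_nat_eq c two_pos
      have hdvd : x ∣ (U x - algebraMap k _ c0) * (U x - algebraMap k _ (-c0)) := by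
        refine ⟨2 * U (U x), ?_⟩
        rw [hc, C_pow] at hP
        rw [map_neg]
        change (U x - C c0) * (U x - -C c0) = _
        linear_combination hP
      rcases hx.dvd_or_dvd hdvd with h1 | h1
      · exact h.not_dvd_sub hx.ne_zero hd hDx hEx (by norm_num) h1
      · exact h.not_dvd_sub hx.ne_zero hd hDx hEx (by norm_num) h1
    have hgen : ∀ s : Set (MvPolynomial (Fin 4) k), f ∈ s → x ∈ s → t ∈ s →
        ∀ (g) (m : k), D g = 0 → E g = m • g → g ∈ Algebra.adjoin k s := by
      intro s hfs hxs hts g m hDg hEg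
      exact h.mem_of_highest (Algebra.subset_adjoin hts) (hmem s hfs hxs) hDg hEg
    refine ⟨x, f, P, { h with
      prime_x := hx, D_x := hDx, T_x := hTx, E_x := hEx2, D_f := hDf, U_f := hUf,
      T_f := hTf, quadric := hP
      invariant := fun g hDg hUg hTg => ?_
      weight_two := fun g hDg hTg hEg => ?_
      highest := hgen _ (by simp) (by simp) (by simp)
      top := ?_
      transcendental_f := ?_
      natDegree_pos := ?_ }⟩
    · have := hf g hDg hUg hTg
      rw [Algebra.adjoin_singleton_eq_range_aeval] at this
      exact this.imp fun q hq => hq.symm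
    · obtain ⟨u, hu, n, rfl, hEu⟩ := hfac g hDg hTg 2 hEg
      rw [Algebra.adjoin_singleton_eq_range_aeval] at hu
      obtain ⟨q, rfl⟩ := hu
      by_cases h0 : Polynomial.aeval f q * x ^ n = 0
      · exact ⟨0, by simpa using h0⟩
      have hn : n = 1 := by
        have hEu' : E (Polynomial.aeval f q) = 0 := hEu
        have h2 : E (Polynomial.aeval f q * x ^ n) =
            ((n : k) * 2) • (Polynomial.aeval f q * x ^ n) := by
          rw [Derivation.leibniz, hEu', Derivation.leibniz_pow, hEx2]
          rcases n with _ | n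
          · simp
          · simp only [Nat.add_sub_cancel, smul_eq_mul, nsmul_eq_mul]
            simp only [Algebra.smul_def, map_mul, map_natCast, map_ofNat]
            ring
        have h3 : ((n : k) * 2 - 2) • (Polynomial.aeval f q * x ^ n) = 0 := by
          rw [sub_smul, ← h2, sub_eq_zero]
          exact hEg
        have h4 := (smul_eq_zero.1 h3).resolve_right h0
        have h5 : ((n : k) - 1) * 2 = 0 := by linear_combination h4
        have h6 := (mul_eq_zero.1 h5).resolve_right two_ne_zero
        exact_mod_cast sub_eq_zero.1 h6
      subst hn
      exact ⟨q, by rw [pow_one]; rfl⟩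
    · refine h.eq_top_of_highest_mem (Algebra.subset_adjoin (by simp))
        (D.mem_adjoin_of_forall ?_) (U.mem_adjoin_of_forall ?_) (hmem _ (by simp) (by simp))
      · rintro a (rfl | rfl | rfl | rfl | rfl)
        · rw [hDf]; exact zero_mem _
        · rw [hDx]; exact zero_mem _
        · rw [h.D_U_highest hDx hEx]
          exact Subalgebra.smul_mem _ (Algebra.subset_adjoin (by simp)) _
        · rw [h.D_U_U_highest hDx hEx]
          exact Subalgebra.smul_mem _ (Algebra.subset_adjoin (by simp)) _
        · rw [h.D_t]; exact zero_mem _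
      · rintro a (rfl | rfl | rfl | rfl | rfl)
        · rw [hUf]; exact zero_mem _
        · exact Algebra.subset_adjoin (by simp)
        · exact Algebra.subset_adjoin (by simp)
        · rw [hUUUx]; exact zero_mem _
        · rw [h.U_t]; exact zero_mem _
    · intro halg
      obtain ⟨c, rfl⟩ := eq_algebraMap_of_isAlgebraic halg
      refine hconst (P.eval c) ?_
      rw [Polynomial.aeval_algebraMap_apply, Polynomial.coe_aeval_eq_eval]
      rfl
    · by_contra h0
      refine hconst (P.coeff 0) ?_
      rw [Polynomial.eq_C_of_natDegree_eq_zero (Nat.eq_zero_of_not_pos h0)]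
      simp
  · -- higher weight
    exfalso
    have hd0 : (d : k) - 1 ≠ 0 := by
      rw [sub_ne_zero]
      exact_mod_cast (by omega : d ≠ 1)
    have hxQ : x ∣ ((d : k) - 1) • U x ^ 2 - (d : k) • (x * U (U x)) := by
      obtain ⟨u, hu, n, hn, hEu⟩ := hfac _ hQD hQT _ hQE
      rcases n with _ | n
      · rw [pow_zero, mul_one] at hn
        have h1 := hQE
        rw [hn, hEu] at h1
        have h2 := (smul_eq_zero.1 h1.symm).resolve_left (by
          rw [show 2 * (d : k) - 4 = 2 * ((d - 2 : ℕ) : k) by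
            rw [Nat.cast_sub hd2.le]; push_cast; ring]
          exact mul_ne_zero two_ne_zero (Nat.cast_ne_zero.2 (by omega)))
        rw [hn, h2]
        exact dvd_zero _
      · rw [hn]
        exact Dvd.intro_left (u * x ^ n) (by ring)
    have hxy : x ∣ C ((d : k) - 1) * U x ^ 2 := by
      obtain ⟨b, hb⟩ := hxQ
      refine ⟨b + C (d : k) * U (U x), ?_⟩
      rw [smul_eq_C_mul, smul_eq_C_mul] at hb
      linear_combination hb
    have hxy2 := (hx.dvd_or_dvd hxy).resolve_left fun h1 =>
      hx.not_isUnit (isUnit_of_dvd_unit h1 (hd0.isUnit.map C))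
    refine h.not_dvd_sub (c := 0) hx.ne_zero hd hDx hEx (by simp) ?_
    rw [map_zero, sub_zero]
    exact hx.dvd_of_dvd_pow hxy2

end IsSl2Cylinder

namespace MvPolynomial

variable {k σ : Type*} [Field k] [Fintype σ] [DecidableEq σ]

theorem derivation_jacobian_eq_sum
    (δ : Derivation k (MvPolynomial σ k) (MvPolynomial σ k)) (g : σ → MvPolynomial σ k) :
    δ (jacobian g) + divergence δ * jacobian g = ∑ i, jacobianDerivation g i (δ (g i)) := by
  rw [derivation_jacobian]
  simp only [jacobianDerivation_apply]

/-- If a derivation into a field extension is determined by its values on `g`, then the Jacobian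
of `g` does not vanish there. -/
theorem algebraMap_jacobian_ne_zero (g : σ → MvPolynomial σ k) {L : Type*} [Field L] [Algebra k L]
    [Algebra (MvPolynomial σ k) L] [IsScalarTower k (MvPolynomial σ k) L]
    (h : ∀ δ : Derivation k (MvPolynomial σ k) L, (∀ i, δ (g i) = 0) → δ = 0) :
    algebraMap (MvPolynomial σ k) L (jacobian g) ≠ 0 := by
  intro h0
  rw [jacobian, RingHom.map_det] at h0
  obtain ⟨v, hv, hMv⟩ := Matrix.exists_mulVec_eq_zero_iff.2 h0
  refine hv ?_
  have hδ := h (mkDerivation k v) fun i => by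
    rw [derivation_eq_sum (mkDerivation k v) (g i), ← Pi.zero_apply (M := fun _ => L) i, ← hMv]
    simp [Matrix.mulVec, dotProduct, Algebra.smul_def]
  ext j
  simpa using congrArg (fun δ => δ (X j)) hδ

end MvPolynomial

theorem Derivation.iterate_pow_of_apply_apply_eq_zero {k R : Type*} [CommRing k] [CommRing R]
    [Algebra k R] (δ : Derivation k R R) {y : R} (hy : δ (δ y) = 0) (n : ℕ) :
    δ^[n] (y ^ n) = n.factorial * δ y ^ n := by
  induction n with
  | zero => simp
  | succ n ih =>
    have h1 : δ (((n + 1 : ℕ) : R) * δ y) = 0 := by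
      rw [Derivation.leibniz, hy, Derivation.map_natCast]; simp
    rw [Function.iterate_succ_apply, Derivation.leibniz_pow, Nat.add_sub_cancel, nsmul_eq_mul,
      smul_eq_mul, mul_comm (y ^ n), ← mul_assoc, Derivation.iterate_mul_of_eq_zero δ h1, ih,
      Nat.factorial_succ]
    push_cast
    ring

namespace IsSl2Quadric

section General

variable {k R : Type*} [Field k] [CharZero k] [CommRing R] [IsDomain R] [Algebra k R]
  {D U E T : Derivation k R R} {t x f : R} {P : Polynomial k}

theorem D_y (h : IsSl2Quadric D U E T t x f P) : D (U x) = (2 : k) • x := by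
  simpa using h.D_U_highest (d := 2) h.D_x (by simpa using h.E_x)

theorem E_y (h : IsSl2Quadric D U E T t x f P) : E (U x) = 0 := by
  simpa using h.E_U_highest (d := 2) (by simpa using h.E_x)

theorem E_f (h : IsSl2Quadric D U E T t x f P) : E f = 0 :=
  h.toIsSl2Cylinder.E_eq_zero h.D_f h.U_f

theorem T_y (h : IsSl2Quadric D U E T t x f P) : T (U x) = 0 := by
  rw [← h.uT, h.T_x, map_zero]

theorem x_mul_E {a : R} (h : IsSl2Quadric D U E T t x f P) {m : k} (ha : E a = m • a) (n : ℕ) :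
    E (x ^ n * a) = (m + 2 * n) • (x ^ n * a) := by
  rw [Derivation.leibniz, Derivation.leibniz_pow, ha, h.E_x]
  cases n with
  | zero => simp
  | succ n =>
    simp only [smul_eq_mul, nsmul_eq_mul]
    simp only [Algebra.smul_def, map_add, map_mul, map_natCast, map_ofNat, Nat.add_sub_cancel]
    ring

theorem exists_pow_mul_mem_of_iterate (h : IsSl2Quadric D U E T t x f P) (n : ℕ) :
    ∀ (a : R) (m : k), E a = m • a → D^[n] a = 0 →
      ∃ N, x ^ N * a ∈ Algebra.adjoin k {f, x, U x, t} := by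
  induction n with
  | zero => intro a m _ h0; exact ⟨0, by rw [show a = 0 from h0, mul_zero]; exact zero_mem _⟩
  | succ n ih =>
    intro a m ha h0
    set c := D^[n] a with hc
    have hDc : D c = 0 := by rw [hc, ← Function.iterate_succ_apply' D, h0]
    have hEc : E c = (m + 2 * n) • c := by
      simpa [mul_comm] using h.isSl2.weight_iterate_D ha n
    have hcm : c ∈ Algebra.adjoin k {f, x, U x, t} :=
      Algebra.adjoin_mono (by intro a; simp; tauto) (h.highest c _ hDc hEc)
    have hDD : D (D (U x)) = 0 := by rw [h.D_y, Derivation.map_smul, h.D_x, smul_zero]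
    have hn : ((n.factorial : k) * 2 ^ n) ≠ 0 := by
      exact mul_ne_zero (Nat.cast_ne_zero.2 n.factorial_ne_zero) (pow_ne_zero _ two_ne_zero)
    set γ : k := ((n.factorial : k) * 2 ^ n)⁻¹ with hγ
    obtain ⟨N, hN⟩ := ih (x ^ n * a - γ • (U x ^ n * c)) (m + 2 * n) (by
      rw [map_sub, h.x_mul_E ha, Derivation.map_smul, Derivation.leibniz, Derivation.leibniz_pow,
        h.E_y, hEc, smul_zero, smul_zero, smul_zero, add_zero, smul_sub, smul_eq_mul,
        mul_smul_comm, smul_comm γ]) (by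
      rw [iterate_map_sub, ← Derivation.coeFn_coe, ← Module.End.coe_pow, map_smul,
        Module.End.coe_pow, Derivation.coeFn_coe,
        Derivation.iterate_mul_of_eq_zero D (by rw [Derivation.leibniz_pow, h.D_x]; simp),
        mul_comm (U x ^ n), Derivation.iterate_mul_of_eq_zero D hDc,
        Derivation.iterate_pow_of_apply_apply_eq_zero D hDD, h.D_y, ← hc]
      have : γ • (c * (n.factorial * ((2 : k) • x) ^ n)) =
          (γ * ((n.factorial : k) * 2 ^ n)) • (c * x ^ n) := by
        simp only [Algebra.smul_def, map_mul, map_natCast, map_pow, map_ofNat]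
        ring
      rw [this, hγ, inv_mul_cancel₀ hn, one_smul, mul_comm, sub_self])
    refine ⟨N + n, ?_⟩
    have hx : x ∈ Algebra.adjoin k {f, x, U x, t} := Algebra.subset_adjoin (by simp)
    have hy : U x ∈ Algebra.adjoin k {f, x, U x, t} := Algebra.subset_adjoin (by simp)
    have := add_mem hN (mul_mem (pow_mem hx N)
      (Subalgebra.smul_mem _ (mul_mem (pow_mem hy n) hcm) γ))
    rwa [← mul_add, sub_add_cancel, ← mul_assoc, ← pow_add] at this

theorem exists_pow_mul_mem (h : IsSl2Quadric D U E T t x f P) (a : R) :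
    ∃ N, x ^ N * a ∈ Algebra.adjoin k {f, x, U x, t} := by
  refine h.weight_induction (p := fun a => ∃ N, x ^ N * a ∈ Algebra.adjoin k {f, x, U x, t})
    (fun d v hv => ?_) ?_ a
  · obtain ⟨n, hn⟩ := h.locNil_D v
    exact h.exists_pow_mul_mem_of_iterate n v _ hv hn
  · rintro v w ⟨N, hN⟩ ⟨M, hM⟩
    have hx : x ∈ Algebra.adjoin k {f, x, U x, t} := Algebra.subset_adjoin (by simp)
    refine ⟨N + M, ?_⟩
    have := add_mem (mul_mem (pow_mem hx M) hN) (mul_mem (pow_mem hx N) hM)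
    convert this using 1
    ring

/-- A derivation into a module on which `x` acts injectively is determined by its values on
`x`, `f`, `U x` and `t`. -/
theorem derivation_eq_zero (h : IsSl2Quadric D U E T t x f P) {L : Type*} [Field L] [Algebra k L]
    [Algebra R L] [IsScalarTower k R L] (hx : algebraMap R L x ≠ 0) (δ : Derivation k R L)
    (h0 : ∀ a ∈ ({f, x, U x, t} : Set R), δ a = 0) : δ = 0 := by
  ext a
  obtain ⟨N, hN⟩ := h.exists_pow_mul_mem a
  have h1 : δ (x ^ N * a) = 0 :=
    Derivation.eqOn_adjoin (D2 := 0) (fun b hb => h0 b hb) hN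
  have hxN : δ (x ^ N) = 0 := by
    rw [Derivation.leibniz_pow, h0 x (by simp)]; simp
  rw [Derivation.leibniz, hxN, smul_zero, add_zero, Algebra.smul_def, map_pow] at h1
  exact (mul_eq_zero.1 h1).resolve_left (pow_ne_zero _ hx)

end General

section Jacobian

open MvPolynomial

variable {k : Type*} [Field k] [CharZero k]
  {D U E T : Derivation k (MvPolynomial (Fin 4) k) (MvPolynomial (Fin 4) k)}
  {t x f : MvPolynomial (Fin 4) k} {P : Polynomial k}

theorem algebraMap_jacobian_ne_zero (h : IsSl2Quadric D U E T t x f P)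
    {L : Type*} [Field L] [Algebra k L]
    [Algebra (MvPolynomial (Fin 4) k) L] [IsScalarTower k (MvPolynomial (Fin 4) k) L]
    (hx : algebraMap (MvPolynomial (Fin 4) k) L x ≠ 0) :
    algebraMap (MvPolynomial (Fin 4) k) L (jacobian ![x, f, U x, t]) ≠ 0 := by
  refine MvPolynomial.algebraMap_jacobian_ne_zero _ fun δ hδ => h.derivation_eq_zero hx δ ?_
  rintro a (rfl | rfl | rfl | rfl)
  exacts [hδ 1, hδ 0, hδ 2, hδ 3]

theorem exists_jacobian_eq (h : IsSl2Quadric D U E T t x f P) :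
    ∃ j : Polynomial k, jacobian ![x, f, U x, t] = Polynomial.aeval f j * x := by
  set g := ![x, f, U x, t] with hg
  have hD := derivation_jacobian_eq_sum D g
  have hT := derivation_jacobian_eq_sum T g
  have hE := derivation_jacobian_eq_sum E g
  have hdD := divergence_eq_zero h.locNil_D
  have hdU := divergence_eq_zero h.locNil_U
  have hdT := divergence_eq_zero h.locNil_T
  have hdE : divergence E = 0 := by
    have : E = ⁅D, U⁆ := by ext a; rw [Derivation.commutator_apply, h.E_eq]
    rw [this, divergence_lie, hdD, hdU, map_zero, map_zero, sub_zero]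
  have g0 : jacobianDerivation g 2 x = 0 := jacobianDerivation_of_ne g (j := 0) (by decide)
  have g1 : jacobianDerivation g 0 x = jacobian g := jacobianDerivation_self g 0
  simp only [Fin.sum_univ_four, hg, Matrix.cons_val] at hD hT hE
  rw [← hg] at hD hT hE
  refine h.weight_two _ ?_ ?_ ?_
  · rw [hdD, zero_mul, add_zero] at hD
    rw [hD, h.D_x, h.D_f, h.D_y, h.D_t]
    simp [g0]
  · rw [hdT, zero_mul, add_zero] at hT
    rw [hT, h.T_x, h.T_f, h.T_y, h.T_t]
    simp
  · rw [hdE, zero_mul, add_zero] at hE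
    rw [hE, h.E_x, h.E_f, h.E_y, h.E_t]
    simp [g1]

theorem exists_jacobian_eq_C [IsAlgClosed k] (h : IsSl2Quadric D U E T t x f P) :
    ∃ c : k, c ≠ 0 ∧ jacobian ![x, f, U x, t] = algebraMap k _ c * x := by
  obtain ⟨j, hj⟩ := h.exists_jacobian_eq
  have hJ : jacobian ![x, f, U x, t] ≠ 0 := by
    have := h.algebraMap_jacobian_ne_zero (L := FractionRing (MvPolynomial (Fin 4) k))
      (by simpa using h.prime_x.ne_zero)
    intro h0
    rw [h0, map_zero] at this
    exact this rfl
  have hj0 : j ≠ 0 := by rintro rfl; simp [hj] at hJ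
  by_cases hdeg : j.degree = 0
  · obtain ⟨c, rfl⟩ : ∃ c, j = Polynomial.C c := ⟨_, Polynomial.eq_C_of_degree_eq_zero hdeg⟩
    refine ⟨c, fun hc => hj0 (by simp [hc]), by simpa using hj⟩
  exfalso
  obtain ⟨a, ha⟩ := IsAlgClosed.exists_root j hdeg
  set u := f - algebraMap k _ a with hu
  have hu0 : u ≠ 0 := fun h0 => h.transcendental_f (by
    rw [sub_eq_zero.1 h0]; exact isAlgebraic_algebraMap a)
  have hDu : D u = 0 := by simp [hu, h.D_f]
  have hUu : U u = 0 := by simp [hu, h.U_f]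
  have huu : ¬ IsUnit u := fun hun => h.transcendental_f (by
    obtain ⟨c, hc⟩ := MvPolynomial.isUnit_iff_eq_C_of_isReduced.1 hun
    rw [sub_eq_iff_eq_add.1 hc.2, ← algebraMap_eq, ← map_add]
    exact isAlgebraic_algebraMap _)
  obtain ⟨π, hπ, hdvd⟩ := WfDvdMonoid.exists_irreducible_factor huu hu0
  have hDπ := Derivation.eq_zero_of_dvd h.locNil_D hu0 hDu hdvd
  have hUπ := Derivation.eq_zero_of_dvd h.locNil_U hu0 hUu hdvd
  have hEπ := h.toIsSl2Cylinder.E_eq_zero hDπ hUπ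
  have hπx : ¬ π ∣ x := by
    intro hd
    obtain ⟨v, hv⟩ := (hπ.dvd_irreducible_iff_associated h.prime_x.irreducible).1 hd
    have hE := h.E_x
    have hEv := h.toIsSl2Cylinder.isUnit_invariant v.isUnit
    have hE' := h.toIsSl2Cylinder.E_eq_zero hEv.1 hEv.2.1
    rw [← hv, Derivation.leibniz, hEπ, hE', smul_zero, smul_zero, add_zero, eq_comm, hv] at hE
    exact h.prime_x.ne_zero ((smul_eq_zero.1 hE).resolve_left two_ne_zero)
  have hprime : (Ideal.span {π}).IsPrime :=
    (Ideal.span_singleton_prime hπ.ne_zero).2 hπ.prime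
  let Q := MvPolynomial (Fin 4) k ⧸ Ideal.span {π}
  let L := FractionRing Q
  have hL : ∀ v : MvPolynomial (Fin 4) k, algebraMap _ L v = 0 ↔ π ∣ v := fun v => by
    rw [IsScalarTower.algebraMap_apply _ Q L, map_eq_zero_iff _ (IsFractionRing.injective Q L),
      Ideal.Quotient.algebraMap_eq, Ideal.Quotient.eq_zero_iff_mem, Ideal.mem_span_singleton]
  refine h.algebraMap_jacobian_ne_zero (L := L) (fun h0 => hπx ((hL x).1 h0)) ?_
  rw [hL, hj]
  refine Dvd.dvd.mul_right (hdvd.trans ?_) _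
  obtain ⟨q, hq⟩ := Polynomial.dvd_iff_isRoot.2 ha
  rw [hq, map_mul]
  simp [hu]

end Jacobian

end IsSl2Quadric

theorem Derivation.span_range_ne_top_of_pos_weight {k R ι : Type*} [Field k] [CharZero k]
    [CommRing R] [IsDomain R] [Algebra k R] (δ : Derivation k R R) (g : ι → R)
    (hg : Algebra.adjoin k (Set.range g) = ⊤) (m : ι → ℕ)
    (hm : ∀ i, δ (g i) = ((m i : k) + 1) • g i) : Ideal.span (Set.range g) ≠ ⊤ := by
  set N : Submodule k R := ⨆ j : ℕ, Module.End.eigenspace δ.toLinearMap ((j : k) + 1) with hN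
  have hgN : ∀ i, g i ∈ N := fun i =>
    Submodule.mem_iSup_of_mem (m i) (Module.End.mem_eigenspace_iff.2 (hm i))
  have hmul : N * N ≤ N := by
    rw [hN]
    simp only [Submodule.iSup_mul, Submodule.mul_iSup]
    refine iSup_le fun i => iSup_le fun j => Submodule.mul_le.2 fun a ha b hb => ?_
    refine Submodule.mem_iSup_of_mem (i + j + 1) (Module.End.mem_eigenspace_iff.2 ?_)
    have ha' : δ a = _ := Module.End.mem_eigenspace_iff.1 ha
    have hb' : δ b = _ := Module.End.mem_eigenspace_iff.1 hb
    change δ (a * b) = _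
    rw [Derivation.leibniz, ha', hb']
    simp only [smul_eq_mul, Algebra.smul_def, map_add, map_natCast, map_one, Nat.cast_add,
      Nat.cast_one]
    ring
  have hall : ∀ a : R, ∃ c : k, a - algebraMap k R c ∈ N := by
    intro a
    have ha : a ∈ Algebra.adjoin k (Set.range g) := hg ▸ Algebra.mem_top
    induction ha using Algebra.adjoin_induction with
    | mem a ha =>
      obtain ⟨i, rfl⟩ := ha
      exact ⟨0, by simpa using hgN i⟩
    | algebraMap c => exact ⟨c, by simp⟩
    | add a b _ _ ha hb =>
      obtain ⟨c, hc⟩ := ha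
      obtain ⟨d, hd⟩ := hb
      refine ⟨c + d, ?_⟩
      convert add_mem hc hd using 1
      rw [map_add]; ring
    | mul a b _ _ ha hb =>
      obtain ⟨c, hc⟩ := ha
      obtain ⟨d, hd⟩ := hb
      refine ⟨c * d, ?_⟩
      convert add_mem (hmul (Submodule.mul_mem_mul hc hd))
        (add_mem (N.smul_mem c hd) (N.smul_mem d hc)) using 1
      rw [map_mul, Algebra.smul_def, Algebra.smul_def]; ring
  have hspan : ∀ a ∈ Ideal.span (Set.range g), a ∈ N := by
    intro a ha
    induction ha using Submodule.span_induction with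
    | mem a ha => obtain ⟨i, rfl⟩ := ha; exact hgN i
    | zero => exact zero_mem _
    | add a b _ _ ha hb => exact add_mem ha hb
    | smul r a _ ha =>
      obtain ⟨c, hc⟩ := hall r
      convert add_mem (hmul (Submodule.mul_mem_mul hc ha)) (N.smul_mem c ha) using 1
      rw [smul_eq_mul, Algebra.smul_def]; ring
  intro htop
  have h1 : (1 : R) ∈ N := hspan 1 (htop ▸ Submodule.mem_top)
  have h0 : (1 : R) ∈ Module.End.eigenspace δ.toLinearMap 0 :=
    Module.End.mem_eigenspace_iff.2 (by simp)
  have hle : N ≤ ⨆ μ, ⨆ _ : μ ≠ (0 : k), Module.End.eigenspace δ.toLinearMap μ :=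
    iSup_le fun j => le_iSup₂_of_le ((j : k) + 1) (Nat.cast_add_one_ne_zero j) le_rfl
  exact one_ne_zero (Submodule.disjoint_def.1
    (Module.End.eigenspaces_iSupIndep δ.toLinearMap 0) 1 h0 (hle h1))

theorem Matrix.exists_isUnit_det_submatrix {L ι σ : Type*} [Field L] [Finite ι] [Fintype σ]
    [DecidableEq σ] (G : Matrix ι σ L) (hG : ∀ v, G.mulVec v = 0 → v = 0) :
    ∃ e : σ → ι, (G.submatrix e id).det ≠ 0 := by
  cases nonempty_fintype ι
  have hrank : Module.finrank L (Submodule.span L (Set.range G.row)) = Fintype.card σ := by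
    rw [← Matrix.rank_eq_finrank_span_row, Matrix.rank, LinearMap.finrank_range_of_inj,
      Module.finrank_fintype_fun_eq_card]
    exact (injective_iff_map_eq_zero _).2 hG
  obtain ⟨r, hr, -, hind⟩ := Submodule.exists_fun_fin_finrank_span_eq L (Set.range G.row)
  choose e he using hr
  let φ : σ ≃ Fin _ := Fintype.equivFinOfCardEq hrank.symm
  refine ⟨e ∘ φ, IsUnit.ne_zero ((Matrix.isUnit_iff_isUnit_det _).1
    (Matrix.linearIndependent_rows_iff_isUnit.1 ?_))⟩
  have : (G.submatrix (e ∘ φ) id).row = r ∘ φ := by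
    ext i j
    simp [← he]
  rw [this]
  exact hind.comp φ φ.injective

namespace MvPolynomial

/-- At a point where homogeneous generators vanish, the weights of a system of parameters chosen
among them add up to the divergence. -/
theorem exists_sum_weight_eq_one {k σ ι : Type*} [Field k] [Fintype σ] [DecidableEq σ] [Finite ι]
    (δ : Derivation k (MvPolynomial σ k) (MvPolynomial σ k)) (hδ : divergence δ = 1)
    (g : ι → MvPolynomial σ k) (hg : Algebra.adjoin k (Set.range g) = ⊤)
    (hI : Ideal.span (Set.range g) ≠ ⊤) (μ : ι → k) (hμ : ∀ i, δ (g i) = μ i • g i) :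
    ∃ e : σ → ι, Function.Injective e ∧ ∑ i, μ (e i) = 1 := by
  obtain ⟨M, hM, hIM⟩ := Ideal.exists_le_maximal _ hI
  have hgM : ∀ i, g i ∈ M := fun i => hIM (Ideal.subset_span ⟨i, rfl⟩)
  let L := MvPolynomial σ k ⧸ M
  let _ : Field L := Ideal.Quotient.field M
  have hδM : ∀ a, δ a ∈ M := by
    intro a
    have ha : a ∈ Algebra.adjoin k (Set.range g) := hg ▸ Algebra.mem_top
    induction ha using Algebra.adjoin_induction with
    | mem a ha =>
      obtain ⟨i, rfl⟩ := ha
      rw [hμ, Algebra.smul_def]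
      exact M.mul_mem_left _ (hgM i)
    | algebraMap c => simp
    | add a b _ _ ha hb => rw [map_add]; exact add_mem ha hb
    | mul a b _ _ ha hb =>
      rw [Derivation.leibniz]
      exact add_mem (M.mul_mem_left _ hb) (M.mul_mem_left _ ha)
  obtain ⟨e, he⟩ := Matrix.exists_isUnit_det_submatrix
    (Matrix.of fun (i : ι) (j : σ) => algebraMap (MvPolynomial σ k) L (pderiv j (g i))) (by
    intro v hv
    have h0 : mkDerivation k v = 0 := by
      ext a
      refine Derivation.eqOn_adjoin (D2 := 0) (s := Set.range g) ?_ (hg ▸ Algebra.mem_top)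
      rintro _ ⟨i, rfl⟩
      rw [derivation_eq_sum (mkDerivation k v) (g i), Derivation.zero_apply,
        ← Pi.zero_apply (M := fun _ => L) i, ← hv]
      simp [Matrix.mulVec, dotProduct, Algebra.smul_def]
    ext j
    simpa using congrArg (fun δ => δ (X j)) h0)
  have hJ : algebraMap (MvPolynomial σ k) L (jacobian (g ∘ e)) ≠ 0 := by
    rw [jacobian, RingHom.map_det]
    exact he
  refine ⟨e, fun a b hab => ?_, ?_⟩
  · by_contra hne
    exact he (Matrix.det_zero_of_row_eq hne (by ext j; simp [hab]))
  have h1 := derivation_jacobian_eq_sum δ (g ∘ e)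
  have h2 : ∀ i, jacobianDerivation (g ∘ e) i (δ ((g ∘ e) i)) = μ (e i) • jacobian (g ∘ e) := by
    intro i
    rw [Function.comp_apply, hμ, Derivation.map_smul]
    congr 1
    exact jacobianDerivation_self (g ∘ e) i
  rw [hδ, one_mul, Finset.sum_congr rfl fun i _ => h2 i, ← Finset.sum_smul] at h1
  have h3 : δ (jacobian (g ∘ e)) = algebraMap k _ (∑ i, μ (e i) - 1) * jacobian (g ∘ e) := by
    rw [eq_sub_of_add_eq h1, Algebra.smul_def, map_sub, map_one]; ring
  have h4 := hδM (jacobian (g ∘ e))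
  rw [h3, ← Ideal.Quotient.eq_zero_iff_mem, map_mul] at h4
  have h5 := (mul_eq_zero.1 h4).resolve_right hJ
  have h6 : algebraMap k L (∑ i, μ (e i) - 1) = 0 := h5
  exact sub_eq_zero.1 ((map_eq_zero _).1 h6)

end MvPolynomial

theorem Polynomial.natDegree_eq_one_of_weight {k : Type*} [Field k] [CharZero k]
    {P p : Polynomial k} (hP : 0 < P.natDegree)
    (h : 2 * (1 - derivative p) * P = derivative P * p) :
    p.natDegree = 1 ∧ ((P.natDegree : k) + 2) * p.coeff 1 = 2 := by
  set n := P.natDegree with hn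
  set d := p.natDegree with hd
  have hP0 : P ≠ 0 := by rintro rfl; simp [hn] at hP
  have hlP : P.coeff n ≠ 0 := by simpa [hn] using hP0
  have hP' : (derivative P).natDegree ≤ n - 1 := natDegree_derivative_le P
  have hcP' : (derivative P).coeff (n - 1) = P.coeff n * n := by
    rw [coeff_derivative, ← Nat.cast_add_one, Nat.sub_add_cancel hP]
  have hd0 : d ≠ 0 := by
    intro h0
    have hp : derivative p = 0 := derivative_of_natDegree_zero h0
    have h1 := congrArg (fun q => q.coeff n) h
    have h2 : (derivative P * p).coeff n = 0 :=
      coeff_eq_zero_of_natDegree_lt (natDegree_mul_le.trans_lt (by omega))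
    simp only [h2, hp, sub_zero, mul_one] at h1
    rw [show (2 : Polynomial k) = C 2 from rfl, coeff_C_mul] at h1
    exact (mul_ne_zero two_ne_zero hlP) h1
  have hlp : p.coeff d ≠ 0 := by
    have : p ≠ 0 := by rintro rfl; simp [hd] at hd0
    simpa [hd] using this
  have hp' : (2 * (1 - derivative p)).natDegree ≤ d - 1 := by
    rw [show (2 : Polynomial k) = C 2 from rfl]
    refine (natDegree_C_mul_le _ _).trans ((natDegree_sub_le _ _).trans ?_)
    simpa only [natDegree_one, zero_le, max_eq_right] using natDegree_derivative_le p
  have hcp' : (derivative p).coeff (d - 1) = p.coeff d * d := by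
    rw [coeff_derivative, ← Nat.cast_add_one, Nat.sub_add_cancel (Nat.pos_of_ne_zero hd0)]
  have h1 := congrArg (fun q => q.coeff (d - 1 + n)) h
  rw [coeff_mul_add_eq_of_natDegree_le hp' hn.ge, show d - 1 + n = n - 1 + d by omega,
    coeff_mul_add_eq_of_natDegree_le hP' hd.ge, hcP', show (2 : Polynomial k) = C 2 from rfl,
    coeff_C_mul, coeff_sub, hcp', coeff_one] at h1
  have hd1 : d = 1 := by
    by_contra hne
    rw [if_neg (by omega)] at h1
    have h2 : P.coeff n * p.coeff d * ((n + 2 * d : ℕ) : k) = 0 := by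
      push_cast; linear_combination -h1
    exact mul_ne_zero (mul_ne_zero hlP hlp) (Nat.cast_ne_zero.2 (by omega)) h2
  refine ⟨hd1, mul_left_cancel₀ hlP ?_⟩
  rw [hd1, if_pos (by omega), Nat.cast_one] at h1
  linear_combination -h1

namespace IsSl2Quadric

open MvPolynomial

variable {k : Type*} [Field k] [CharZero k] [IsAlgClosed k]
  {D U E T : Derivation k (MvPolynomial (Fin 4) k) (MvPolynomial (Fin 4) k)}
  {t x f : MvPolynomial (Fin 4) k} {P : Polynomial k}

theorem exists_eigen_derivation (h : IsSl2Quadric D U E T t x f P) :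
    ∃ (Δ : Derivation k (MvPolynomial (Fin 4) k) (MvPolynomial (Fin 4) k)) (c a : k),
      divergence Δ = 1 ∧ ((P.natDegree : k) + 2) * c = 2 ∧ Δ t = 0 ∧
      Δ (f - algebraMap k _ a) = c • (f - algebraMap k _ a) ∧ Δ x = (1 - c) • x ∧
      Δ (U x) = (1 - c) • U x ∧ Δ (U (U x)) = (1 - c) • U (U x) := by
  obtain ⟨Δ, hΔt, hΔ, hΔD, hΔU, hΔT⟩ := h.toIsSl2Cylinder.exists_equivariant (by simp)
  have hΔE : ∀ v, Δ (E v) = E (Δ v) := fun v => by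
    rw [h.E_eq, h.E_eq, map_sub, hΔD, hΔU, hΔU, hΔD]
  obtain ⟨p, hp⟩ := h.invariant (Δ f) (by rw [← hΔD, h.D_f, map_zero])
    (by rw [← hΔU, h.U_f, map_zero]) (by rw [← hΔT, h.T_f, map_zero])
  obtain ⟨r, hr⟩ := h.weight_two (Δ x) (by rw [← hΔD, h.D_x, map_zero])
    (by rw [← hΔT, h.T_x, map_zero]) (by rw [← hΔE, h.E_x, Derivation.map_smul])
  have hy : Δ (U x) = Polynomial.aeval f r * U x := by
    rw [hΔU, hr, Derivation.leibniz, Derivation.map_aeval, h.U_f]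
    simp
  have hw : Δ (U (U x)) = Polynomial.aeval f r * U (U x) := by
    rw [hΔU, hy, Derivation.leibniz, Derivation.map_aeval, h.U_f]
    simp
  have hinj : ∀ q₁ q₂ : Polynomial k, Polynomial.aeval f q₁ = Polynomial.aeval f q₂ → q₁ = q₂ :=
    fun _ _ hq => transcendental_iff_injective.1 h.transcendental_f hq
  obtain ⟨c, hc, hJ⟩ := h.exists_jacobian_eq_C
  have hrp : r = 1 - Polynomial.derivative p := by
    refine hinj _ _ ?_
    set g := ![x, f, U x, t] with hg
    have h1 := derivation_jacobian_eq_sum Δ g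
    have g0 : jacobianDerivation g 0 x = jacobian g := jacobianDerivation_self g 0
    have g1 : jacobianDerivation g 1 f = jacobian g := jacobianDerivation_self g 1
    have g2 : jacobianDerivation g 2 (U x) = jacobian g := jacobianDerivation_self g 2
    have g3 : jacobianDerivation g 0 f = 0 := jacobianDerivation_of_ne g (j := 1) (by decide)
    have g4 : jacobianDerivation g 2 f = 0 := jacobianDerivation_of_ne g (j := 1) (by decide)
    simp only [Fin.sum_univ_four, hg, Matrix.cons_val] at h1
    rw [← hg, hΔ, hr, hp, hy, hΔt, Derivation.leibniz, Derivation.leibniz, Derivation.map_aeval,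
      Derivation.map_aeval, Derivation.map_aeval, g0, g1, g2, g3, g4, map_zero, hJ,
      Derivation.leibniz, Derivation.map_algebraMap, hr] at h1
    have hcx : algebraMap k (MvPolynomial (Fin 4) k) c * x ≠ 0 :=
      mul_ne_zero ((map_ne_zero_iff _ (FaithfulSMul.algebraMap_injective k _)).2 hc)
        h.prime_x.ne_zero
    refine mul_left_cancel₀ hcx ?_
    simp only [smul_eq_mul, smul_zero, mul_zero, map_sub, map_one] at h1 ⊢
    linear_combination -h1
  have hPp : 2 * (1 - Polynomial.derivative p) * P = Polynomial.derivative P * p := by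
    refine hinj _ _ ?_
    have h1 := congrArg Δ h.quadric
    rw [Derivation.map_aeval, hp, map_sub, Derivation.leibniz_pow, Derivation.leibniz,
      Derivation.leibniz, hy, hw, hr] at h1
    rw [← hrp, map_mul, map_mul, map_mul, ← h.quadric]
    have h2 : Δ 2 = 0 := by simpa using Derivation.map_natCast Δ 2
    simp only [smul_eq_mul, nsmul_eq_mul, map_ofNat, Nat.cast_ofNat, h2] at h1 ⊢
    linear_combination h1
  obtain ⟨hdeg, hcoeff⟩ := Polynomial.natDegree_eq_one_of_weight h.natDegree_pos hPp
  set l := p.coeff 1 with hl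
  have hpl : p = Polynomial.C l * Polynomial.X + Polynomial.C (p.coeff 0) :=
    Polynomial.eq_X_add_C_of_natDegree_le_one hdeg.le
  have hl0 : l ≠ 0 := by
    intro h0
    rw [h0, mul_zero] at hcoeff
    exact two_ne_zero hcoeff.symm
  have hrl : Polynomial.aeval f r = algebraMap k _ (1 - l) := by
    rw [hrp, hpl]; simp
  refine ⟨Δ, l, -(p.coeff 0 / l), hΔ, hcoeff, hΔt, ?_, ?_, ?_, ?_⟩
  · have hpf : Polynomial.aeval f p = algebraMap k _ l * f + algebraMap k _ (p.coeff 0) :=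
      (congrArg _ hpl).trans (by simp)
    rw [map_sub, hp, Derivation.map_algebraMap, hpf, Algebra.smul_def]
    have : algebraMap k (MvPolynomial (Fin 4) k) (p.coeff 0) =
        algebraMap k _ l * algebraMap k _ (p.coeff 0 / l) := by
      rw [← map_mul, mul_div_cancel₀ _ hl0]
    rw [map_neg, this]
    ring
  · rw [hr, hrl, Algebra.smul_def]
  · rw [hy, hrl, Algebra.smul_def]
  · rw [hw, hrl, Algebra.smul_def]

theorem natDegree_eq_one (h : IsSl2Quadric D U E T t x f P) : P.natDegree = 1 := by
  obtain ⟨Δ, c, a, hΔ, hc, ht, hf, hx, hy, hw⟩ := h.exists_eigen_derivation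
  obtain ⟨n, hn⟩ := Nat.exists_eq_succ_of_ne_zero h.natDegree_pos.ne'
  rw [hn] at hc ⊢
  push_cast at hc
  have hTw : T (U (U x)) = 0 := by rw [← h.uT, h.T_y, map_zero]
  set u := f - algebraMap k (MvPolynomial (Fin 4) k) a with hu
  have hTu : T u = 0 := by rw [hu, map_sub, h.T_f, Derivation.map_algebraMap, sub_zero]
  set g : Fin 5 → MvPolynomial (Fin 4) k := ![u, x, U x, U (U x), t] with hg
  have htop : Algebra.adjoin k (Set.range g) = ⊤ := by
    rw [eq_top_iff, ← h.top]
    have hm : ∀ i, g i ∈ Algebra.adjoin k (Set.range g) := fun i => Algebra.subset_adjoin ⟨i, rfl⟩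
    refine Algebra.adjoin_le ?_
    rintro b (rfl | rfl | rfl | rfl | rfl)
    · have := add_mem (hm 0) (Subalgebra.algebraMap_mem _ a)
      simpa [hg, hu] using this
    exacts [hm 1, hm 2, hm 3, hm 4]
  have hproper : Ideal.span (Set.range g) ≠ ⊤ := by
    refine Derivation.span_range_ne_top_of_pos_weight
      (((n : k) + 3) • Δ + (((n : k) + 3) • t) • T) g htop ![1, n, n, n, n + 2] fun i => ?_
    simp only [Derivation.add_apply, Derivation.smul_apply]
    have e1 : ((n : k) + 3) * c = 1 + 1 := by linear_combination hc
    have e2 : ((n : k) + 3) * (1 - c) = n + 1 := by linear_combination -hc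
    fin_cases i <;> simp only [hg, Fin.zero_eta, Fin.mk_one, Fin.reduceFinMk, Matrix.cons_val]
    · rw [hf, hTu, smul_zero, add_zero, smul_smul, e1, Nat.cast_one]
    · rw [hx, h.T_x, smul_zero, add_zero, smul_smul, e2]
    · rw [hy, h.T_y, smul_zero, add_zero, smul_smul, e2]
    · rw [hw, hTw, smul_zero, add_zero, smul_smul, e2]
    · rw [ht, h.T_t, smul_zero, zero_add, smul_eq_mul, mul_one]
      congr 1
      push_cast
      ring
  obtain ⟨e, he, hsum⟩ := exists_sum_weight_eq_one Δ hΔ g htop hproper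
    ![c, 1 - c, 1 - c, 1 - c, 0] fun i => by
      fin_cases i <;> simp only [hg, Fin.zero_eta, Fin.mk_one, Fin.reduceFinMk, Matrix.cons_val]
      exacts [hf, hx, hy, hw, by rw [ht, zero_smul]]
  set μ : Fin 5 → k := ![c, 1 - c, 1 - c, 1 - c, 0] with hμ
  obtain ⟨o, ho⟩ : ∃ o, ∀ i, e i ≠ o := by
    by_contra! hcon
    simpa using Fintype.card_le_of_surjective e hcon
  have himg : Finset.univ.image e = Finset.univ.erase o := by
    refine Finset.eq_of_subset_of_card_le (fun j hj => ?_) ?_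
    · obtain ⟨i, -, rfl⟩ := Finset.mem_image.1 hj
      exact Finset.mem_erase.2 ⟨ho i, Finset.mem_univ _⟩
    · rw [Finset.card_image_of_injective _ he]; simp
  have hsum2 : μ o + 1 = 1 + 2 * (1 - c) := by
    have hadd := Finset.add_sum_erase Finset.univ μ (Finset.mem_univ o)
    rw [← himg, Finset.sum_image (fun a _ b _ hab => he hab), hsum, Fin.sum_univ_five] at hadd
    rw [hadd]
    simp only [hμ, Matrix.cons_val]
    ring
  have hn1 : ((n + 1 : ℕ) : k) ≠ 0 := Nat.cast_ne_zero.2 (by omega)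
  have hc1 : 1 - c ≠ 0 := fun h0 => hn1 (by
    push_cast
    linear_combination hc + ((n : k) + 3) * h0)
  have hmain : μ o = c := by
    fin_cases o <;> simp only [hμ, Fin.zero_eta, Fin.mk_one, Fin.reduceFinMk, Matrix.cons_val]
      at hsum2 ⊢
    · exact absurd (by linear_combination -hsum2) hc1
    · exact absurd (by linear_combination -hsum2) hc1
    · exact absurd (by linear_combination -hsum2) hc1
    · exact absurd (mul_eq_zero.1 (show 2 * (1 - c) = 0 by linear_combination -hsum2))
        (by simp [hc1])
  rw [hmain] at hsum2
  have : (n : k) = 0 := by linear_combination (3/2 : k) * hc - (((n : k) + 3) / 2) * hsum2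
  rw [Nat.cast_eq_zero] at this
  omega

theorem generated (h : IsSl2Quadric D U E T t x f P) :
    Algebra.adjoin k {x, U x, U (U x), t} = ⊤ := by
  have hdeg := h.natDegree_eq_one
  have hP : P = Polynomial.C (P.coeff 1) * Polynomial.X + Polynomial.C (P.coeff 0) :=
    Polynomial.eq_X_add_C_of_natDegree_le_one hdeg.le
  have hl : P.coeff 1 ≠ 0 := by
    rw [← hdeg, Polynomial.coeff_natDegree, Polynomial.leadingCoeff_ne_zero]
    rintro rfl
    simp at hdeg
  set S := Algebra.adjoin k {x, U x, U (U x), t} with hS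
  have hx : x ∈ S := Algebra.subset_adjoin (by simp)
  have hy : U x ∈ S := Algebra.subset_adjoin (by simp)
  have hw : U (U x) ∈ S := Algebra.subset_adjoin (by simp)
  have ht : t ∈ S := Algebra.subset_adjoin (by simp)
  have hq := h.quadric
  rw [hP, map_add, map_mul, Polynomial.aeval_C, Polynomial.aeval_C, Polynomial.aeval_X] at hq
  have hf : f = (P.coeff 1)⁻¹ • (U x ^ 2 - 2 * x * U (U x) - algebraMap k _ (P.coeff 0)) := by
    rw [hq, add_sub_cancel_right, ← Algebra.smul_def, inv_smul_smul₀ hl]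
  have hfS : f ∈ S := by
    rw [hf]
    exact S.smul_mem (sub_mem (sub_mem (pow_mem hy 2) (mul_mem (mul_mem (ofNat_mem S 2) hx) hw))
      (S.algebraMap_mem _)) _
  rw [eq_top_iff, ← h.top]
  refine Algebra.adjoin_le ?_
  rintro b (rfl | rfl | rfl | rfl | rfl)
  exacts [hfS, hx, hy, hw, ht]

end IsSl2Quadric

theorem IsSl2Cylinder.exists_generators {k : Type*} [Field k] [CharZero k] [IsAlgClosed k]
    {D U E T : Derivation k (MvPolynomial (Fin 4) k) (MvPolynomial (Fin 4) k)}
    {t : MvPolynomial (Fin 4) k} (h : IsSl2Cylinder D U E T t) (hD : ∃ v, D v ≠ 0) :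
    ∃ a b c, T a = 0 ∧ T b = 0 ∧ T c = 0 ∧ Algebra.adjoin k {a, b, c, t} = ⊤ := by
  rcases h.generated_or_quadric hD with hgen | ⟨x, f, P, hq⟩
  · exact hgen
  · exact ⟨x, U x, U (U x), hq.T_x, hq.T_y, by rw [← h.uT, hq.T_y, map_zero], hq.generated⟩

namespace Derivation

variable {k A : Type*} [CommRing k] [CommRing A] [Algebra k A]

/-- Extend a derivation coefficientwise to polynomials. -/
noncomputable def polynomialMap (δ : Derivation k A A) :
    Derivation k (Polynomial A) (Polynomial A) :=
  PolynomialModule.equivPolynomialSelf.compDer δ.mapCoeffs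

theorem coeff_polynomialMap (δ : Derivation k A A) (p : Polynomial A) (n : ℕ) :
    (δ.polynomialMap p).coeff n = δ (p.coeff n) := rfl

theorem coeff_iterate_polynomialMap (δ : Derivation k A A) (p : Polynomial A) (m n : ℕ) :
    (δ.polynomialMap^[m] p).coeff n = δ^[m] (p.coeff n) := by
  induction m with
  | zero => rfl
  | succ m ih => rw [Function.iterate_succ_apply', Function.iterate_succ_apply',
      coeff_polynomialMap, ih]

theorem locNil_polynomialMap {δ : Derivation k A A} (hδ : LocNil δ) :
    LocNil δ.polynomialMap := by
  intro p
  choose m hm using fun n => hδ (p.coeff n)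
  refine ⟨p.support.sup m, Polynomial.ext fun n => ?_⟩
  rw [coeff_iterate_polynomialMap, Polynomial.coeff_zero]
  by_cases hn : n ∈ p.support
  · exact iterate_eq_zero_of_le (map_zero δ) (Finset.le_sup hn) (hm n)
  · rw [Polynomial.notMem_support_iff.1 hn, Function.iterate_fixed (map_zero δ)]

/-- The derivative of polynomials as a derivation over the base ring. -/
noncomputable def polynomialDerivative (k A : Type*) [CommRing k] [CommRing A] [Algebra k A] :
    Derivation k (Polynomial A) (Polynomial A) :=
  (Polynomial.derivative' (R := A)).restrictScalars k

theorem polynomialDerivative_apply (p : Polynomial A) :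
    polynomialDerivative k A p = Polynomial.derivative p := rfl

theorem locNil_polynomialDerivative : LocNil (polynomialDerivative k A) := fun p =>
  ⟨p.natDegree + 1, Polynomial.iterate_derivative_eq_zero (Nat.lt_succ_self _)⟩

/-- Transport a derivation along an isomorphism. -/
def conj {R S : Type*} [CommRing R] [Algebra k R] [CommRing S] [Algebra k S] (φ : R ≃ₐ[k] S)
    (δ : Derivation k R R) : Derivation k S S :=
  Derivation.mk' (φ.toLinearMap ∘ₗ δ.toLinearMap ∘ₗ φ.symm.toLinearMap) fun a b => by
    simp

theorem conj_apply {R S : Type*} [CommRing R] [Algebra k R] [CommRing S] [Algebra k S]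
    (φ : R ≃ₐ[k] S) (δ : Derivation k R R) (v : S) : conj φ δ v = φ (δ (φ.symm v)) := rfl

theorem locNil_conj {R S : Type*} [CommRing R] [Algebra k R] [CommRing S] [Algebra k S]
    (φ : R ≃ₐ[k] S) {δ : Derivation k R R} (hδ : LocNil δ) : LocNil (conj φ δ) := by
  intro v
  have h : ∀ n, (conj φ δ)^[n] v = φ (δ^[n] (φ.symm v)) := by
    intro n
    induction n with
    | zero => simp
    | succ n ih => rw [Function.iterate_succ_apply', Function.iterate_succ_apply', ih, conj_apply,
        AlgEquiv.symm_apply_apply]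
  obtain ⟨n, hn⟩ := hδ (φ.symm v)
  exact ⟨n, by rw [h, hn, map_zero]⟩

end Derivation

theorem IsSl2Cylinder.conj {k R S : Type*} [Field k] [CommRing R] [Algebra k R] [CommRing S]
    [Algebra k S] {D U E T : Derivation k R R} {t : R} (h : IsSl2Cylinder D U E T t)
    (φ : R ≃ₐ[k] S) :
    IsSl2Cylinder (D.conj φ) (U.conj φ) (E.conj φ) (T.conj φ) (φ t) where
  du v := by simp [Derivation.conj_apply, h.du]
  ed v := by simp [Derivation.conj_apply, h.ed]
  eu v := by simp [Derivation.conj_apply, h.eu]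
  locNil_D := Derivation.locNil_conj φ h.locNil_D
  locNil_U := Derivation.locNil_conj φ h.locNil_U
  locNil_T := Derivation.locNil_conj φ h.locNil_T
  dT v := by simp [Derivation.conj_apply, h.dT]
  uT v := by simp [Derivation.conj_apply, h.uT]
  T_t := by simp [Derivation.conj_apply, h.T_t]
  D_t := by simp [Derivation.conj_apply, h.D_t]
  U_t := by simp [Derivation.conj_apply, h.U_t]
  weights := by
    rw [eq_top_iff]
    rintro v -
    suffices ∀ w : R, φ w ∈ ⨆ d : ℤ, Module.End.eigenspace (E.conj φ).toLinearMap (d : k) by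
      simpa using this (φ.symm v)
    intro w
    refine h.weight_induction (p := fun w => φ w ∈
      ⨆ d : ℤ, Module.End.eigenspace (E.conj φ).toLinearMap (d : k)) (fun d w hw => ?_)
      (fun a b ha hb => by rw [map_add]; exact add_mem ha hb) w
    refine Submodule.mem_iSup_of_mem d (Module.End.mem_eigenspace_iff.2 ?_)
    change E.conj φ (φ w) = _
    rw [Derivation.conj_apply, AlgEquiv.symm_apply_apply, hw, map_smul]

namespace IsFundamentalPair

section Field

variable {k B : Type*} [Field k] [CommRing B] [Algebra k B] {D U : Derivation k B B}

theorem ed (h : IsFundamentalPair D U) (v : B) : ⁅D, U⁆ (D v) = D (⁅D, U⁆ v) + (2 : k) • D v := by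
  have h1 := congrArg (fun δ : Derivation k B B => δ v) h.2.2.1
  simp only [Derivation.commutator_apply (D1 := D) (D2 := ⁅D, U⁆), Derivation.smul_apply] at h1
  rw [neg_smul, ofNat_zsmul, two_nsmul] at h1
  rw [two_smul]
  linear_combination -h1

theorem eu (h : IsFundamentalPair D U) (v : B) : ⁅D, U⁆ (U v) = U (⁅D, U⁆ v) - (2 : k) • U v := by
  have h1 := congrArg (fun δ : Derivation k B B => δ v) h.2.2.2.1
  simp only [Derivation.commutator_apply (D1 := U) (D2 := ⁅D, U⁆), Derivation.smul_apply] at h1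
  rw [ofNat_zsmul, two_nsmul] at h1
  rw [two_smul]
  linear_combination -h1

theorem exists_D_ne_zero [CharZero k] (h : IsFundamentalPair D U) (hne : ¬(D = 0 ∧ U = 0)) :
    ∃ v, D v ≠ 0 := by
  by_contra! hD
  have hD0 : D = 0 := Derivation.ext hD
  refine hne ⟨hD0, Derivation.ext fun v => ?_⟩
  have h1 := h.eu v
  rw [hD0, zero_lie, Derivation.zero_apply, Derivation.zero_apply, map_zero, zero_sub, eq_comm,
    neg_eq_zero] at h1
  exact (smul_eq_zero.1 h1).resolve_left two_ne_zero

theorem isSl2Cylinder (h : IsFundamentalPair D U) :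
    IsSl2Cylinder D.polynomialMap U.polynomialMap ⁅D, U⁆.polynomialMap
      (Derivation.polynomialDerivative k B) Polynomial.X where
  du v := by
    ext n
    simp [Derivation.coeff_polynomialMap, Derivation.commutator_apply]
  ed v := by
    ext n
    simp only [Derivation.coeff_polynomialMap, Polynomial.coeff_add, Polynomial.coeff_smul, h.ed]
  eu v := by
    ext n
    simp only [Derivation.coeff_polynomialMap, Polynomial.coeff_sub, Polynomial.coeff_smul, h.eu]
  locNil_D := Derivation.locNil_polynomialMap fun b => by
    obtain ⟨n, hn⟩ := h.1 b
    exact ⟨n, by rwa [Module.End.coe_pow] at hn⟩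
  locNil_U := Derivation.locNil_polynomialMap fun b => by
    obtain ⟨n, hn⟩ := h.2.1 b
    exact ⟨n, by rwa [Module.End.coe_pow] at hn⟩
  locNil_T := Derivation.locNil_polynomialDerivative
  dT v := by
    ext n
    simp [Derivation.coeff_polynomialMap, Derivation.polynomialDerivative_apply,
      Polynomial.coeff_derivative, Derivation.leibniz, ← Nat.cast_add_one, -Nat.cast_add]
    ring
  uT v := by
    ext n
    simp [Derivation.coeff_polynomialMap, Derivation.polynomialDerivative_apply,
      Polynomial.coeff_derivative, Derivation.leibniz, ← Nat.cast_add_one, -Nat.cast_add]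
    ring
  T_t := by simp [Derivation.polynomialDerivative_apply]
  D_t := by
    ext n
    simp [Derivation.coeff_polynomialMap, Polynomial.coeff_X, apply_ite D]
  U_t := by
    ext n
    simp [Derivation.coeff_polynomialMap, Polynomial.coeff_X, apply_ite U]
  weights := by
    rw [eq_top_iff]
    rintro p -
    induction p using Polynomial.induction_on' with
    | add p q hp hq => exact add_mem hp hq
    | monomial n b =>
      have hb : b ∈ ⨆ d : ℤ, gradePiece D U d := by rw [h.2.2.2.2]; trivial
      induction hb using Submodule.iSup_induction' with
      | mem d b hb =>
        refine Submodule.mem_iSup_of_mem d (Module.End.mem_eigenspace_iff.2 ?_)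
        change ⁅D, U⁆.polynomialMap _ = _
        have hb' : ⁅D, U⁆ b = (d : k) • b := by
          rw [Int.cast_smul_eq_zsmul]
          exact sub_eq_zero.1 (LinearMap.mem_ker.1 hb)
        ext m
        rw [Derivation.coeff_polynomialMap, Polynomial.coeff_smul, Polynomial.coeff_monomial]
        split_ifs <;> simp [hb']
      | zero => simp
      | add a b _ _ ha hb => rw [map_add]; exact add_mem ha hb

end Field

end IsFundamentalPair

theorem nonempty_algEquiv_mvPolynomial_of_adjoin {k B : Type*} [Field k] [CommRing B] [IsDomain B]
    [Algebra k B] {n : ℕ} (hdim : ringKrullDim B = n) (g : Fin n → B)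
    (hg : Algebra.adjoin k (Set.range g) = ⊤) : Nonempty (B ≃ₐ[k] MvPolynomial (Fin n) k) := by
  have hsurj : Function.Surjective (MvPolynomial.aeval (R := k) g) := by
    rw [← AlgHom.range_eq_top, ← Algebra.adjoin_range_eq_range_aeval, hg]
  have hinj : Function.Injective (MvPolynomial.aeval (R := k) g) := by
    rw [injective_iff_map_eq_zero]
    intro q hq
    by_contra hq0
    have h1 := ringKrullDim_succ_le_of_surjective (MvPolynomial.aeval (R := k) g).toRingHom hsurj
      (mem_nonZeroDivisors_of_ne_zero hq0) hq
    rw [hdim, MvPolynomial.ringKrullDim_of_isNoetherianRing, ringKrullDim_eq_zero_of_field] at h1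
    simp at h1
    norm_cast at h1
    omega
  exact ⟨(AlgEquiv.ofBijective _ ⟨hinj, hsurj⟩).symm⟩

/-- cancelation: over an algebraically closed field `k` of characteristic
zero, if `B` is an affine `k`-domain of dimension 3 with `B[t] ≅ k^[4]` and `B` admits a
nontrivial fundamental pair (i.e. a nontrivial `SL₂(k)`-action), then `B ≅ k^[3]`. -/
theorem stmt_19 {k B : Type*} [Field k] [CharZero k] [IsAlgClosed k]
    [CommRing B] [IsDomain B] [Algebra k B] [Algebra.FiniteType k B]
    (hdim : ringKrullDim B = 3)
    (hcyl : Nonempty (Polynomial B ≃ₐ[k] MvPolynomial (Fin 4) k))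
    (D U : Derivation k B B) (hDU : IsFundamentalPair D U) (hnt : ¬(D = 0 ∧ U = 0)) :
    Nonempty (B ≃ₐ[k] MvPolynomial (Fin 3) k) := by
  obtain ⟨φ⟩ := hcyl
  obtain ⟨v, hv⟩ := hDU.exists_D_ne_zero hnt
  obtain ⟨a, b, c, ha, hb, hc, htop⟩ := (hDU.isSl2Cylinder.conj φ).exists_generators
    ⟨φ (Polynomial.C v), fun h0 => hv (by
      rw [Derivation.conj_apply, AlgEquiv.symm_apply_apply, EmbeddingLike.map_eq_zero_iff] at h0
      simpa [Derivation.coeff_polynomialMap] using congrArg (fun p => p.coeff 0) h0)⟩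
  let ε : MvPolynomial (Fin 4) k →ₐ[k] B :=
    ((Polynomial.aeval (R := B) (0 : B)).restrictScalars k).comp φ.symm.toAlgHom
  have hε : Function.Surjective ε := fun b => ⟨φ (Polynomial.C b), by simp [ε]⟩
  refine nonempty_algEquiv_mvPolynomial_of_adjoin hdim ![ε a, ε b, ε c] ?_
  have h1 : (Algebra.adjoin k {a, b, c, φ Polynomial.X}).map ε = ⊤ := by
    rw [htop, Algebra.map_top, AlgHom.range_eq_top]
    exact hε
  rw [eq_top_iff, ← h1, AlgHom.map_adjoin]
  have hm : ∀ i, ![ε a, ε b, ε c] i ∈ Algebra.adjoin k (Set.range ![ε a, ε b, ε c]) :=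
    fun i => Algebra.subset_adjoin ⟨i, rfl⟩
  refine Algebra.adjoin_le ?_
  rintro _ ⟨q, rfl | rfl | rfl | rfl, rfl⟩
  · exact hm 0
  · exact hm 1
  · exact hm 2
  · simp [ε]
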